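/- arXiv:0706.0541 — 7 statements merged into one kernel-verified Lean document; each statement's English description precedes it below -/
import Mathlib

section
/- The group of all permutations of the 32-element set Λ̃ that preserve the adjacency relation has order 23040. (In the paper this is the group Aut Λ of permutations of the 32 lines on V_{f,δ} respecting the intersection pairing; the Galois representation ρ : Gal(m_g/k_g) → Aut Λ is injective with image of order 23040 and is generically surjective, so Aut Λ has order 23040.) -/
/-- The relation on subsets of `{1,…,6}` identifying a subset with its complement. -/
def lamRel (I J : Finset (Fin 6)) : Prop := J = I ∨ J = Iᶜ

instance : DecidableRel lamRel := fun I J => inferInstanceAs (Decidable (J = I ∨ J = Iᶜ))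

/-- `lamRel` is an equivalence relation. -/
def lamSetoid : Setoid (Finset (Fin 6)) where
  r := lamRel
  iseqv := by
    constructor
    · intro I; left; rfl
    · rintro I J (rfl | rfl)
      · left; rfl
      · right; rw [compl_compl]
    · rintro I J K (rfl | rfl) h <;> rcases h with (rfl | rfl) <;>
        simp [lamRel, compl_compl]

/-- The 32-element set `Λ̃` of classes of subsets of `{1,…,6}` modulo complementation. -/
def Lam : Type := Quotient lamSetoid

/-- Two classes are adjacent if (for representatives) the symmetric difference has
cardinality `1` or `5`; this condition is independent of the choice of representatives. -/
def lamAdj (a b : Lam) : Prop :=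
  ∃ I J : Finset (Fin 6), a = Quotient.mk lamSetoid I ∧ b = Quotient.mk lamSetoid J ∧
    ((symmDiff I J).card = 1 ∨ (symmDiff I J).card = 5)

def lamMk (I : Finset (Fin 6)) : Lam := Quotient.mk lamSetoid I

theorem lamMk_eq {I J : Finset (Fin 6)} : lamMk I = lamMk J ↔ (J = I ∨ J = Iᶜ) :=
  ⟨fun h => Quotient.exact h, fun h => Quotient.sound h⟩

theorem lamMk_surj (a : Lam) : ∃ I, a = lamMk I := by
  obtain ⟨I, hI⟩ := Quotient.exists_rep a
  exact ⟨I, hI.symm⟩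

theorem lam_cl (I J : Finset (Fin 6)) : symmDiff Iᶜ J = (symmDiff I J)ᶜ := by
  ext x; simp only [Finset.mem_symmDiff, Finset.mem_compl]; tauto

theorem lam_cr (I J : Finset (Fin 6)) : symmDiff I Jᶜ = (symmDiff I J)ᶜ := by
  ext x; simp only [Finset.mem_symmDiff, Finset.mem_compl]; tauto

theorem lam_empty (I : Finset (Fin 6)) : symmDiff I ∅ = I := symmDiff_bot I

theorem lam_empty_left (I : Finset (Fin 6)) : symmDiff ∅ I = I := bot_symmDiff I

theorem lamMk_symmDiff (v : Finset (Fin 6)) {I J : Finset (Fin 6)} :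
    lamMk (symmDiff v I) = lamMk (symmDiff v J) ↔ lamMk I = lamMk J := by
  rw [lamMk_eq, lamMk_eq, ← lam_cr, symmDiff_right_inj, symmDiff_right_inj]

theorem lamAdj_mk (I J : Finset (Fin 6)) :
    lamAdj (lamMk I) (lamMk J) ↔ ((symmDiff I J).card = 1 ∨ (symmDiff I J).card = 5) := by
  constructor
  · rintro ⟨I', J', hI, hJ, h⟩
    have hI := lamMk_eq.1 hI
    have hJ := lamMk_eq.1 hJ
    have hc : ∀ K : Finset (Fin 6), Kᶜ.card = 6 - K.card := fun K => by
      rw [Finset.card_compl, Fintype.card_fin]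
    rcases hI with rfl | rfl <;> rcases hJ with rfl | rfl <;>
      (try simp only [lam_cl, lam_cr, compl_compl, hc] at h) <;> omega
  · intro h
    exact ⟨I, J, rfl, rfl, h⟩

theorem lam_one_five : ∀ K : Finset (Fin 6), (K.card = 1 ∨ K.card = 5) →
    ∃ j : Fin 6, K = {j} ∨ K = {j}ᶜ := by decide +kernel

theorem lam_common : ∀ i j : Fin 6, i ≠ j → ∀ Y : Finset (Fin 6),
    ((symmDiff {i} Y).card = 1 ∨ (symmDiff {i} Y).card = 5) →
    ((symmDiff {j} Y).card = 1 ∨ (symmDiff {j} Y).card = 5) →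
    (Y = ∅ ∨ Y = ∅ᶜ) ∨ (Y = {i, j} ∨ Y = {i, j}ᶜ) := by decide +kernel

theorem lam_single_inj : ∀ i j : Fin 6, ({j} : Finset (Fin 6)) = {i} ∨
    ({j} : Finset (Fin 6)) = {i}ᶜ → i = j := by decide +kernel

theorem lam_pair_ne : ∀ i j : Fin 6, i ≠ j →
    ¬ (({i, j} : Finset (Fin 6)) = ∅ ∨ ({i, j} : Finset (Fin 6)) = ∅ᶜ) := by decide +kernel

theorem lam_pair_adj : ∀ i j : Fin 6, i ≠ j →
    (symmDiff ({i} : Finset (Fin 6)) {i, j}).card = 1 ∧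
    (symmDiff ({j} : Finset (Fin 6)) {i, j}).card = 1 := by decide +kernel

theorem lam_sd (I A B : Finset (Fin 6)) :
    symmDiff (symmDiff I A) (symmDiff I B) = symmDiff A B := by
  ext x; simp only [Finset.mem_symmDiff]; tauto

/-- The square-completion step. -/
theorem lam_step (g : Equiv.Perm Lam) (hg : ∀ a b : Lam, lamAdj (g a) (g b) ↔ lamAdj a b)
    (I : Finset (Fin 6)) (i j : Fin 6) (hij : i ≠ j)
    (h0 : g (lamMk I) = lamMk I)
    (hi : g (lamMk (symmDiff I {i})) = lamMk (symmDiff I {i}))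
    (hj : g (lamMk (symmDiff I {j})) = lamMk (symmDiff I {j})) :
    g (lamMk (symmDiff I {i, j})) = lamMk (symmDiff I {i, j}) := by
  obtain ⟨X, hX⟩ := lamMk_surj (g (lamMk (symmDiff I {i, j})))
  obtain ⟨Y, rfl⟩ : ∃ Y, X = symmDiff I Y := ⟨symmDiff I X, by simp⟩
  have a1 : lamAdj (g (lamMk (symmDiff I {i}))) (g (lamMk (symmDiff I {i, j}))) := by
    rw [hg, lamAdj_mk, lam_sd]; exact Or.inl (lam_pair_adj i j hij).1
  have a2 : lamAdj (g (lamMk (symmDiff I {j}))) (g (lamMk (symmDiff I {i, j}))) := by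
    rw [hg, lamAdj_mk, lam_sd]; exact Or.inl (lam_pair_adj i j hij).2
  rw [hi, hX, lamAdj_mk, lam_sd] at a1
  rw [hj, hX, lamAdj_mk, lam_sd] at a2
  rcases lam_common i j hij Y a1 a2 with h | h
  · exfalso
    have h1 : lamMk (symmDiff I ∅) = lamMk (symmDiff I Y) :=
      (lamMk_symmDiff I).2 (lamMk_eq.2 h)
    have h2 : lamMk (symmDiff I {i, j}) = lamMk (symmDiff I ∅) := by
      apply g.injective
      rw [hX, ← h1]
      simpa [lam_empty] using h0.symm
    exact lam_pair_ne i j hij (lamMk_eq.1 ((lamMk_symmDiff I).1 h2).symm)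
  · rw [hX]
    exact ((lamMk_symmDiff I).2 (lamMk_eq.2 h)).symm

theorem lam_rigid (g : Equiv.Perm Lam) (hg : ∀ a b : Lam, lamAdj (g a) (g b) ↔ lamAdj a b)
    (h0 : g (lamMk ∅) = lamMk ∅) (h1 : ∀ i, g (lamMk {i}) = lamMk {i}) :
    ∀ (n : ℕ) (I : Finset (Fin 6)), I.card = n → g (lamMk I) = lamMk I := by
  intro n
  induction n using Nat.strong_induction_on with
  | _ n ih =>
    intro I hI
    by_cases hn : n ≤ 1
    · rcases Nat.le_one_iff_eq_zero_or_eq_one.1 hn with rfl | rfl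
      · rw [Finset.card_eq_zero.1 hI]; exact h0
      · obtain ⟨i, rfl⟩ := Finset.card_eq_one.1 hI
        exact h1 i
    · obtain ⟨i, hi, j, hj, hij⟩ := Finset.one_lt_card.1 (show 1 < I.card by omega)
      have key := lam_step g hg ((I.erase i).erase j) i j hij
      have e1 : symmDiff ((I.erase i).erase j) {i} = I.erase j := by
        ext x; simp only [Finset.mem_symmDiff, Finset.mem_erase, Finset.mem_singleton]; grind
      have e2 : symmDiff ((I.erase i).erase j) {j} = I.erase i := by
        ext x; simp only [Finset.mem_symmDiff, Finset.mem_erase, Finset.mem_singleton]; grind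
      have e3 : symmDiff ((I.erase i).erase j) {i, j} = I := by
        ext x
        simp only [Finset.mem_symmDiff, Finset.mem_erase, Finset.mem_singleton,
          Finset.mem_insert]
        grind
      rw [e1, e2, e3] at key
      have c1 : (I.erase i).card < n := hI ▸ Finset.card_erase_lt_of_mem hi
      have c2 : (I.erase j).card < n := hI ▸ Finset.card_erase_lt_of_mem hj
      have c3 : ((I.erase i).erase j).card < n :=
        lt_of_le_of_lt (Finset.card_le_card (Finset.erase_subset _ _)) c1
      exact key (ih _ c3 _ rfl) (ih _ c2 _ rfl) (ih _ c1 _ rfl)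

theorem lam_image_sd (s : Equiv.Perm (Fin 6)) (I J : Finset (Fin 6)) :
    symmDiff (I.image s) (J.image s) = (symmDiff I J).image s :=
  (Finset.image_symmDiff I J s.injective).symm

theorem lam_image_compl (s : Equiv.Perm (Fin 6)) (I : Finset (Fin 6)) :
    Iᶜ.image s = (I.image s)ᶜ := by
  ext x
  simp only [Finset.mem_image, Finset.mem_compl]
  constructor
  · rintro ⟨a, ha, rfl⟩ ⟨b, hb, hab⟩
    exact ha (s.injective hab ▸ hb)
  · intro h
    exact ⟨s.symm x, fun hx => h ⟨_, hx, by simp⟩, by simp⟩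

/-- The affine map `I ↦ v Δ s(I)` on classes. -/
def lamFun (v : Finset (Fin 6)) (s : Equiv.Perm (Fin 6)) : Lam → Lam :=
  Quotient.lift (fun I => lamMk (symmDiff v (I.image s))) (by
    intro I J h
    have h : lamMk I = lamMk J := Quotient.sound h
    apply (lamMk_symmDiff v).2
    rw [lamMk_eq] at h ⊢
    rcases h with rfl | rfl
    · exact Or.inl rfl
    · exact Or.inr (lam_image_compl s I))

theorem lamFun_mk (v : Finset (Fin 6)) (s : Equiv.Perm (Fin 6)) (I : Finset (Fin 6)) :
    lamFun v s (lamMk I) = lamMk (symmDiff v (I.image s)) := rfl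

theorem lamFun_bij (v : Finset (Fin 6)) (s : Equiv.Perm (Fin 6)) :
    Function.Bijective (lamFun v s) := by
  constructor
  · intro a b h
    obtain ⟨I, rfl⟩ := lamMk_surj a
    obtain ⟨J, rfl⟩ := lamMk_surj b
    rw [lamFun_mk, lamFun_mk, lamMk_symmDiff, lamMk_eq, ← lam_image_compl] at h
    rw [lamMk_eq]
    exact h.imp (fun h => Finset.image_injective s.injective h)
      (fun h => Finset.image_injective s.injective h)
  · intro b
    obtain ⟨J, rfl⟩ := lamMk_surj b
    refine ⟨lamMk ((symmDiff v J).image s.symm), ?_⟩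
    rw [lamFun_mk, Finset.image_image]
    simp

noncomputable def lamPhi
    (p : {v : Finset (Fin 6) // (0 : Fin 6) ∉ v} × Equiv.Perm (Fin 6)) :
    {g : Equiv.Perm Lam // ∀ a b : Lam, lamAdj (g a) (g b) ↔ lamAdj a b} :=
  ⟨Equiv.ofBijective _ (lamFun_bij p.1.1 p.2), by
    intro a b
    obtain ⟨I, rfl⟩ := lamMk_surj a
    obtain ⟨J, rfl⟩ := lamMk_surj b
    simp only [Equiv.ofBijective_apply, lamFun_mk, lamAdj_mk, lam_sd, lam_image_sd,
      Finset.card_image_of_injective _ p.2.injective]⟩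

theorem lamPhi_mk (p : {v : Finset (Fin 6) // (0 : Fin 6) ∉ v} × Equiv.Perm (Fin 6))
    (I : Finset (Fin 6)) :
    (lamPhi p).1 (lamMk I) = lamMk (symmDiff p.1.1 (I.image p.2)) := rfl

theorem lamPhi_bij : Function.Bijective lamPhi := by
  constructor
  · rintro ⟨⟨v, hv⟩, s⟩ ⟨⟨w, hw⟩, t⟩ h
    have hI : ∀ I : Finset (Fin 6), lamMk (symmDiff v (I.image s)) =
        lamMk (symmDiff w (I.image t)) := by
      intro I
      have := congrArg (fun f => f.1 (lamMk I)) h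
      simpa only [lamPhi_mk] using this
    have h0 := hI ∅
    simp only [Finset.image_empty, lam_empty, lamMk_eq] at h0
    have hvw : w = v := by
      rcases h0 with h0 | h0
      · simpa using h0
      · exfalso
        apply hw
        have h0 : w = vᶜ := by simpa using h0
        rw [h0]; simpa using hv
    subst hvw
    have hst : s = t := by
      ext1 i
      have h1 := hI {i}
      rw [lamMk_symmDiff, lamMk_eq, Finset.image_singleton, Finset.image_singleton] at h1
      exact lam_single_inj _ _ h1
    rw [hst]
  · rintro ⟨g, hg⟩
    obtain ⟨v, hv, hgv⟩ : ∃ v : Finset (Fin 6), (0 : Fin 6) ∉ v ∧ g (lamMk ∅) = lamMk v := by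
      obtain ⟨v, hv⟩ := lamMk_surj (g (lamMk ∅))
      by_cases h : (0 : Fin 6) ∈ v
      · exact ⟨vᶜ, by simpa using h, hv.trans (lamMk_eq.2 (Or.inr rfl))⟩
      · exact ⟨v, h, hv⟩
    have hs : ∀ i : Fin 6, ∃ j : Fin 6, g (lamMk {i}) = lamMk (symmDiff v {j}) := by
      intro i
      obtain ⟨X, hX⟩ := lamMk_surj (g (lamMk {i}))
      have a : lamAdj (g (lamMk ∅)) (g (lamMk {i})) := by
        rw [hg, lamAdj_mk]; left; simp [lam_empty_left]
      rw [hgv, hX, lamAdj_mk] at a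
      obtain ⟨j, hj⟩ := lam_one_five _ a
      refine ⟨j, ?_⟩
      have hXv : X = symmDiff v (symmDiff v X) := by simp
      rw [hX, hXv, lamMk_symmDiff]
      exact (lamMk_eq.2 hj).symm
    choose s hs using hs
    have hinj : Function.Injective s := by
      intro i j hij
      have : lamMk {i} = lamMk {j} := g.injective (by rw [hs, hs, hij])
      exact lam_single_inj _ _ (lamMk_eq.1 this)
    have hbij : Function.Bijective s := Finite.injective_iff_bijective.1 hinj
    let p : {v : Finset (Fin 6) // (0 : Fin 6) ∉ v} × Equiv.Perm (Fin 6) :=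
      ⟨⟨v, hv⟩, Equiv.ofBijective s hbij⟩
    refine ⟨p, ?_⟩
    have hf := (lamPhi p).2
    have e0 : (lamPhi p).1 (lamMk ∅) = g (lamMk ∅) := by
      rw [lamPhi_mk, hgv]; simp [p, lam_empty]
    have e1 : ∀ i, (lamPhi p).1 (lamMk {i}) = g (lamMk {i}) := by
      intro i
      rw [lamPhi_mk, hs]; simp [p]
    have R := lam_rigid ((lamPhi p).1.trans g.symm)
      (by
        intro a b
        rw [← hf a b, ← hg]
        simp)
      (by simp [e0]) (by intro i; simp [e1])
    apply Subtype.ext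
    ext a
    obtain ⟨I, rfl⟩ := lamMk_surj a
    have := R _ I rfl
    rw [Equiv.trans_apply, Equiv.symm_apply_eq] at this
    exact this

/-- The group of all permutations of the 32-element set `Λ̃` preserving the
adjacency relation (i.e. `Aut Λ`, the permutations of the 32 lines on `V_{f,δ}` respecting
the intersection pairing) has order `23040`. -/
theorem statement9 :
    Nat.card {g : Equiv.Perm Lam // ∀ a b : Lam, lamAdj (g a) (g b) ↔ lamAdj a b} = 23040 := by
  rw [← Nat.card_eq_of_bijective _ lamPhi_bij, Nat.card_prod, Nat.card_perm]
  have h : Nat.card {v : Finset (Fin 6) // (0 : Fin 6) ∉ v} = 32 := by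
    rw [Nat.card_eq_fintype_card]; decide +kernel
  rw [h, Nat.card_eq_fintype_card, Fintype.card_fin]
  rfl
end

section
/- Let σ ∈ Gal(k̄/k) and fix ε₀ ∈ A ⊗_k k̄ with ε₀² = δ ⊗ 1. Then σ fixes every line 𝓛_ε (for all ε ∈ A ⊗_k k̄ with ε² = δ ⊗ 1) if and only if σ fixes every root ω ∈ Ω of f and σ fixes the single line 𝓛_{ε₀}. (This is the statement that the compositum l·k(L) equals the field of definition k([Λ]) of the full configuration of 32 lines, for any line L.) -/
open Polynomial TensorProduct

/-- For `ε ∈ k̄ ⊗_k A` with `ε² = 1 ⊗ δ`, the line `𝓛_ε` is the 2-dimensional `k̄`-subspace of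
`k̄ ⊗_k A` spanned by `ε⁻¹` and `ε⁻¹·(1 ⊗ x)`. -/
noncomputable def lineK {k K : Type*} [Field k] [Field K] [Algebra k K]
    (f : Polynomial k) (ε : K ⊗[k] AdjoinRoot f) : Submodule K (K ⊗[k] AdjoinRoot f) :=
  Submodule.span K {Ring.inverse ε,
    Ring.inverse ε * Algebra.TensorProduct.includeRight (AdjoinRoot.root f)}

section helpers

variable {k K : Type*} [Field k] [Field K] [Algebra k K]

/-- The evaluation of `K ⊗ k[X]/(f)` at a root `ω` of `f`. -/
noncomputable def evK (f : Polynomial k) (ω : K) (h : aeval ω f = 0) :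
    K ⊗[k] AdjoinRoot f →ₐ[K] K :=
  Algebra.TensorProduct.lift (AlgHom.id K K) (AdjoinRoot.liftAlgHom f (Algebra.ofId k K) ω (by rw [← h]; rfl))
    (fun _ _ => Commute.all _ _)

/-- The class of `X`. -/
noncomputable def xK (K : Type*) [Field K] [Algebra k K] (f : Polynomial k) : K ⊗[k] AdjoinRoot f :=
  Algebra.TensorProduct.includeRight (AdjoinRoot.root f)

lemma evK_xK (f : Polynomial k) (ω : K) (h : aeval ω f = 0) : evK f ω h (xK K f) = ω := by
  rw [evK, xK, Algebra.TensorProduct.includeRight_apply, Algebra.TensorProduct.lift_tmul]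
  simp

lemma evK_aeval (f : Polynomial k) (ω : K) (h : aeval ω f = 0) (p : K[X]) :
    evK f ω h (aeval (xK K f) p) = p.eval ω := by
  rw [← Polynomial.aeval_algHom_apply, evK_xK, Polynomial.coe_aeval_eq_eval]

lemma exists_aeval (f : Polynomial k) (a : K ⊗[k] AdjoinRoot f) :
    ∃ p : K[X], aeval (xK K f) p = a := by
  induction a using TensorProduct.induction_on with
  | zero => exact ⟨0, by simp⟩
  | add a b ha hb =>
    obtain ⟨p, rfl⟩ := ha
    obtain ⟨q, rfl⟩ := hb
    exact ⟨p + q, by simp⟩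
  | tmul c a =>
    obtain ⟨p, rfl⟩ := AdjoinRoot.mk_surjective a
    refine ⟨C c * p.map (algebraMap k K), ?_⟩
    have h1 : aeval (xK K f) (p.map (algebraMap k K)) = (1 : K) ⊗ₜ[k] AdjoinRoot.mk f p := by
      rw [aeval_map_algebraMap, xK, Polynomial.aeval_algHom_apply, AdjoinRoot.aeval_eq]
      rfl
    rw [map_mul, h1, aeval_C, Algebra.TensorProduct.algebraMap_apply,
      Algebra.TensorProduct.tmul_mul_tmul]
    simp

lemma aeval_xK_self (f : Polynomial k) : aeval (xK K f) (f.map (algebraMap k K)) = 0 := by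
  rw [aeval_map_algebraMap, xK, Polynomial.aeval_algHom_apply, AdjoinRoot.aeval_eq]
  simp

lemma evK_inj [IsAlgClosed K] (f : Polynomial k) (hsep : f.Separable)
    (a b : K ⊗[k] AdjoinRoot f) (h : ∀ ω h, evK f ω h a = evK f ω h b) : a = b := by
  obtain ⟨p, rfl⟩ := exists_aeval f a
  obtain ⟨q, rfl⟩ := exists_aeval f b
  simp only [evK_aeval] at h
  rw [← sub_eq_zero, ← map_sub]
  have hd : f.map (algebraMap k K) ∣ p - q := by
    by_cases hpq : p - q = 0
    · rw [hpq]; exact dvd_zero _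
    refine (IsAlgClosed.splits (f.map (algebraMap k K))).dvd_of_roots_le_roots
      (Polynomial.map_ne_zero hsep.ne_zero) ?_
    refine (Multiset.le_iff_subset (nodup_roots hsep.map)).2 fun ω hω => ?_
    rw [mem_roots hpq]
    rw [mem_roots (Polynomial.map_ne_zero hsep.ne_zero), IsRoot, eval_map_algebraMap] at hω
    simp [IsRoot, h ω hω]
  obtain ⟨r, hr⟩ := hd
  rw [hr, map_mul, aeval_xK_self, zero_mul]

lemma evK_map (f : Polynomial k) (σ : K ≃ₐ[k] K) (ω : K) (h : aeval ω f = 0)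
    (h' : aeval (σ ω) f = 0) (a : K ⊗[k] AdjoinRoot f) :
    evK f (σ ω) h' (Algebra.TensorProduct.map σ.toAlgHom (AlgHom.id k (AdjoinRoot f)) a)
      = σ (evK f ω h a) := by
  induction a using TensorProduct.induction_on with
  | zero => simp
  | add a b ha hb => simp only [map_add, ha, hb]
  | tmul c a =>
    obtain ⟨p, rfl⟩ := AdjoinRoot.mk_surjective a
    have e : aeval (σ ω) p = σ (aeval ω p) := Polynomial.aeval_algHom_apply σ ω p
    simp only [evK, Algebra.TensorProduct.map_tmul, Algebra.TensorProduct.lift_tmul, map_mul,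
      AlgHom.id_apply]
    have l : ∀ (w : K) hw, AdjoinRoot.liftAlgHom f (Algebra.ofId k K) w hw (AdjoinRoot.mk f p)
       = aeval w p := fun w hw => by simp [aeval_def]
    rw [l, l, e]
    rfl

lemma mem_lineK (f : Polynomial k) (ε y : K ⊗[k] AdjoinRoot f) :
    y ∈ lineK f ε ↔ ∃ a b : K, y = Ring.inverse ε * (a • 1 + b • xK K f) := by
  rw [lineK, Submodule.mem_span_pair]
  refine exists_congr fun a => exists_congr fun b => ?_
  rw [mul_add, mul_smul_comm, mul_smul_comm, mul_one, eq_comm]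
  rfl

lemma mem_lineK_mul (f : Polynomial k) (s ε y : K ⊗[k] AdjoinRoot f) (hs : s * s = 1) :
    y ∈ lineK f (s * ε) ↔ s * y ∈ lineK f ε := by
  have hi : Ring.inverse s = s := by
    have := Ring.inverse_unit (⟨s, s, hs, hs⟩ : (K ⊗[k] AdjoinRoot f)ˣ)
    exact this
  simp only [mem_lineK]
  refine exists_congr fun a => exists_congr fun b => ?_
  rw [Ring.mul_inverse_rev, hi]
  constructor
  · rintro rfl
    linear_combination (Ring.inverse ε * (a • 1 + b • xK K f)) * hs
  · intro h
    linear_combination s * h - y * hs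

end helpers

/-- Let `k` be a field of characteristic `≠ 2` with algebraic closure `K`,
`f ∈ k[X]` separable of degree 6, `A = k[X]/(f)`, and `δ ∈ A` a unit.  Let
`σ ∈ Gal(K/k)` act on `A ⊗_k K` via `id ⊗ σ` and fix `ε₀` with `ε₀² = δ ⊗ 1`.  Then `σ` fixes
every line `𝓛_ε` (for all `ε` with `ε² = δ ⊗ 1`) if and only if `σ` fixes every root `ω` of `f`
and `σ` fixes the single line `𝓛_{ε₀}`.  (That is, `l·k(L) = k([Λ])`.) -/
theorem statement11 {k K : Type*} [Field k] [Field K] [Algebra k K] [IsAlgClosure k K]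
    (hchar : (2 : k) ≠ 0)
    (f : Polynomial k) (hsep : f.Separable) (hdeg : f.natDegree = 6)
    (δ : AdjoinRoot f) (hδ : IsUnit δ)
    (σ : K ≃ₐ[k] K)
    (ε₀ : K ⊗[k] AdjoinRoot f)
    (hε₀ : ε₀ ^ 2 = Algebra.TensorProduct.includeRight δ) :
    (∀ ε : K ⊗[k] AdjoinRoot f, ε ^ 2 = Algebra.TensorProduct.includeRight δ →
        (Algebra.TensorProduct.map σ.toAlgHom (AlgHom.id k (AdjoinRoot f))) ''
            (lineK f ε : Set (K ⊗[k] AdjoinRoot f)) = (lineK f ε : Set (K ⊗[k] AdjoinRoot f)))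
      ↔ ((∀ ω ∈ f.aroots K, σ ω = ω) ∧
        (Algebra.TensorProduct.map σ.toAlgHom (AlgHom.id k (AdjoinRoot f))) ''
            (lineK f ε₀ : Set (K ⊗[k] AdjoinRoot f)) =
          (lineK f ε₀ : Set (K ⊗[k] AdjoinRoot f))) := by
  have hK : IsAlgClosed K := IsAlgClosure.isAlgClosed k
  have h2 : (2 : K) ≠ 0 := by
    have := (map_ne_zero (algebraMap k K)).2 hchar
    rwa [map_ofNat] at this
  have hf0 : f.map (algebraMap k K) ≠ 0 := Polynomial.map_ne_zero hsep.ne_zero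
  have hu0 : IsUnit ε₀ := by
    have : IsUnit (ε₀ ^ 2) := by rw [hε₀]; exact hδ.map _
    exact (isUnit_pow_iff two_ne_zero).1 this
  have hroot : ∀ ω : K, aeval ω f = 0 → aeval (σ ω) f = 0 := fun ω h => by
    have e : aeval (σ ω) f = σ (aeval ω f) := Polynomial.aeval_algHom_apply σ ω f
    rw [e, h, map_zero]
  set S := Algebra.TensorProduct.map σ.toAlgHom (AlgHom.id k (AdjoinRoot f)) with hS
  constructor
  · intro H
    refine ⟨fun ω hω => ?_, H ε₀ hε₀⟩
    by_contra hne
    have hω0 : aeval ω f = 0 := (mem_aroots.1 hω).2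
    classical
    -- the involution with sign -1 exactly at ω
    set R : Finset K := (f.aroots K).toFinset with hR
    have hRc : R.card = 6 := by
      rw [hR, Multiset.toFinset_card_of_nodup (nodup_roots hsep.map), ← hdeg,
        ← natDegree_map (algebraMap k K)]
      exact (IsAlgClosed.splits _).natDegree_eq_card_roots.symm
    have hRm : ∀ w, w ∈ R ↔ aeval w f = 0 := fun w => by
      rw [hR, Multiset.mem_toFinset, mem_aroots]
      exact ⟨fun h => h.2, fun h => ⟨hsep.ne_zero, h⟩⟩
    set p : K[X] := Lagrange.interpolate R id (fun w => if w = ω then (-1 : K) else 1) with hp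
    have hpe : ∀ w, aeval w f = 0 → p.eval w = if w = ω then (-1 : K) else 1 := fun w hw => by
      have := Lagrange.eval_interpolate_at_node (s := R) (v := id)
        (fun w => if w = ω then (-1 : K) else 1) Function.injective_id.injOn ((hRm w).2 hw)
      exact this
    set s := aeval (xK K f) p with hsdef
    have hsv : ∀ w hw, evK f w hw s = if w = ω then (-1 : K) else 1 := fun w hw => by
      rw [hsdef, evK_aeval, hpe w hw]
    have hs : s * s = 1 := by
      apply evK_inj f hsep
      intro w hw
      rw [map_mul, hsv, map_one]
      split_ifs <;> simp
    have hε : (s * ε₀) ^ 2 = Algebra.TensorProduct.includeRight δ := by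
      rw [← hε₀, mul_pow, pow_two s, hs, one_mul]
    have H1 := H _ hε
    have H0 := H _ hε₀
    have hv : Ring.inverse ε₀ ∈ (lineK f ε₀ : Set (K ⊗[k] AdjoinRoot f)) :=
      (mem_lineK f _ _).2 ⟨1, 0, by simp⟩
    rw [← H0] at hv
    obtain ⟨u, hu, huv⟩ := hv
    have hsu : S (s * u) ∈ (lineK f (s * ε₀) : Set (K ⊗[k] AdjoinRoot f)) := by
      rw [← H1]
      refine ⟨s * u, ?_, rfl⟩
      refine (mem_lineK_mul f s ε₀ _ hs).2 ?_
      rw [← mul_assoc, hs, one_mul]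
      exact hu
    obtain ⟨a, b, hab⟩ := (mem_lineK f _ _).1 ((mem_lineK_mul f s ε₀ _ hs).1 hsu)
    rw [map_mul, huv] at hab
    have hkey : s * S s = a • 1 + b • xK K f := by
      have hc := Ring.mul_inverse_cancel ε₀ hu0
      linear_combination ε₀ * hab + (a • 1 + b • xK K f - s * S s) * hc
    have hval : ∀ w (hw : aeval w f = 0),
        (if σ w = ω then (-1 : K) else 1) * σ (if w = ω then (-1 : K) else 1)
          = a + b * σ w := fun w hw => by
      have := congrArg (evK f (σ w) (hroot w hw)) hkey
      rw [map_mul, hS, evK_map f σ w hw, hsv, hsv] at this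
      simpa [evK_xK] using this
    -- two further roots
    have hc : 1 < (R \ {ω, σ.symm ω}).card := by
      have h1 := Finset.le_card_sdiff {ω, σ.symm ω} R
      have h3 : ({ω, σ.symm ω} : Finset K).card ≤ 2 := Finset.card_le_two
      omega
    obtain ⟨w₁, hw₁, w₂, hw₂, hww⟩ := Finset.one_lt_card.1 hc
    have hgood : ∀ w ∈ R \ {ω, σ.symm ω}, a + b * σ w = 1 := fun w hw => by
      simp only [Finset.mem_sdiff, Finset.mem_insert, Finset.mem_singleton, not_or] at hw
      obtain ⟨hw, hwa, hwb⟩ := hw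
      have := hval w ((hRm w).1 hw)
      have hwc : σ w ≠ ω := fun h => hwb (by rw [← h]; simp)
      rw [if_neg hwa, if_neg hwc] at this
      simpa using this.symm
    have e1 := hgood w₁ hw₁
    have e2 := hgood w₂ hw₂
    have hb : b = 0 := by
      have : b * (σ w₁ - σ w₂) = 0 := by linear_combination e1 - e2
      rcases mul_eq_zero.1 this with h | h
      · exact h
      · exact absurd (σ.injective (sub_eq_zero.1 h)) hww
    have e3 := hval ω hω0
    rw [if_neg hne, if_pos rfl] at e3
    simp only [map_neg, map_one] at e3
    apply h2
    rw [hb] at e1 e3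
    linear_combination -e1 + -e3
  · rintro ⟨Hr, H0⟩ ε hε
    set s := ε * Ring.inverse ε₀ with hsdef
    have hc := Ring.mul_inverse_cancel ε₀ hu0
    have hs : s * s = 1 := by
      have h : ε ^ 2 = ε₀ ^ 2 := hε.trans hε₀.symm
      rw [hsdef]
      linear_combination Ring.inverse ε₀ ^ 2 * h + (ε₀ * Ring.inverse ε₀ + 1) * hc
    have hεs : ε = s * ε₀ := by
      rw [hsdef]
      linear_combination -ε * hc
    have hSs : S s = s := by
      apply evK_inj f hsep
      intro w hw
      have hσ : σ w = w := Hr w (mem_aroots.2 ⟨hsep.ne_zero, hw⟩)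
      have h1 := evK_map f σ w hw (hroot w hw) s
      have h3 : evK f w hw s * evK f w hw s = 1 := by rw [← map_mul, hs, map_one]
      have h4 : σ (evK f w hw s) = evK f w hw s := by
        rcases mul_self_eq_one_iff.1 h3 with h | h <;> rw [h] <;> simp
      rw [h4] at h1
      simp only [hσ] at h1
      exact h1
    rw [hεs]
    ext y
    constructor
    · rintro ⟨z, hz, rfl⟩
      refine (mem_lineK_mul f s ε₀ _ hs).2 ?_
      have hz' := (mem_lineK_mul f s ε₀ _ hs).1 hz
      have : S (s * z) ∈ (lineK f ε₀ : Set (K ⊗[k] AdjoinRoot f)) := by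
        rw [← H0]; exact ⟨_, hz', rfl⟩
      rw [map_mul, hSs] at this
      exact this
    · intro hy
      have hy' : s * y ∈ (lineK f ε₀ : Set (K ⊗[k] AdjoinRoot f)) :=
        (mem_lineK_mul f s ε₀ _ hs).1 hy
      rw [← H0] at hy'
      obtain ⟨z, hz, hzy⟩ := hy'
      refine ⟨s * z, (mem_lineK_mul f s ε₀ _ hs).2 ?_, ?_⟩
      · rw [← mul_assoc, hs, one_mul]; exact hz
      · rw [map_mul, hSs, hzy, ← mul_assoc, hs, one_mul]
end

section
/- Let l ⊆ k̄ be the splitting field of f over k, let m = l(√(δ_ω·δ_ψ) : ω, ψ ∈ Ω) and m' = l(√(δ_ω) : ω ∈ Ω), the subfields of k̄ obtained by adjoining square roots of the indicated elements. Then k ⊆ l ⊆ m ⊆ m', and each of the extensions l/k, m/k and m'/k is Galois (normal and separable). -/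
open Polynomial

lemma aux_galois {k K : Type*} [Field k] [Field K] [Algebra k K] [IsAlgClosure k K]
    (S : Set K) (hS : ∀ x ∈ S, IsSeparable k x)
    (hσ : ∀ σ : K →ₐ[k] K, ∀ x ∈ S, σ x ∈ S) :
    IsGalois k (IntermediateField.adjoin k S) := by
  have : Normal k K := IsAlgClosure.normal k K
  have : Algebra.IsSeparable k (IntermediateField.adjoin k S) :=
    (IntermediateField.isSeparable_adjoin_iff_isSeparable k K).2 hS
  have : Normal k (IntermediateField.adjoin k S) := by
    rw [IntermediateField.normal_iff_forall_map_le]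
    intro σ
    rw [IntermediateField.adjoin_map]
    apply IntermediateField.adjoin.mono
    rintro _ ⟨x, hx, rfl⟩
    exact hσ σ x hx
  exact ⟨⟩

lemma aux_sqrt {k K : Type*} [Field k] [Field K] [Algebra k K]
    (hchar : (2 : k) ≠ 0) (a s : K) (ha : IsSeparable k a) (ha0 : a ≠ 0) (hs : s ^ 2 = a) :
    IsSeparable k s := by
  let E := separableClosure k K
  let b : E := ⟨a, mem_separableClosure_iff.2 ha⟩
  have hb : b ≠ 0 := fun h => ha0 (congrArg Subtype.val h)
  have h2 : ((2 : ℕ) : E) ≠ 0 := by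
    have := (map_ne_zero (algebraMap k E)).2 hchar
    rw [map_ofNat] at this
    exact_mod_cast this
  have hsep : (X ^ 2 - C b : E[X]).Separable := separable_X_pow_sub_C b h2 hb
  have : IsSeparable E s := by
    apply Separable.of_dvd hsep
    apply minpoly.dvd
    simp [hs, b, IntermediateField.algebraMap_apply]
  exact IsSeparable.of_algebra_isSeparable_of_isSeparable k this

/-- Let `k` be a field of characteristic `≠ 2` with algebraic closure `K`,
`f ∈ k[X]` separable of degree `6`, `A = k[X]/(f)` and `δ ∈ A` a unit; for each root `ω` of
`f` in `K` let `φ ω : A →ₐ[k] K` be the `k`-algebra homomorphism with `x ↦ ω` and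
`δ_ω = φ_ω(δ)`.  Let `l` be the splitting field of `f` in `K`, `m = l(√(δ_ω δ_ψ) : ω,ψ)` and
`m' = l(√δ_ω : ω)`.  Then `k ⊆ l ⊆ m ⊆ m'` and each of `l/k`, `m/k`, `m'/k` is Galois. -/
theorem statement13 {k K : Type*} [Field k] [Field K] [Algebra k K] [IsAlgClosure k K]
    (hchar : (2 : k) ≠ 0)
    (f : Polynomial k) (hsep : f.Separable) (hdeg : f.natDegree = 6)
    (δ : AdjoinRoot f) (hδ : IsUnit δ)
    (φ : K → (AdjoinRoot f →ₐ[k] K))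
    (hφ : ∀ ω ∈ f.aroots K, φ ω (AdjoinRoot.root f) = ω)
    (l m m' : IntermediateField k K)
    (hl : l = IntermediateField.adjoin k {ω : K | ω ∈ f.aroots K})
    (hm : m = IntermediateField.adjoin k
        ({ω : K | ω ∈ f.aroots K} ∪
          {s : K | ∃ ω ∈ f.aroots K, ∃ ψ ∈ f.aroots K, s ^ 2 = φ ω δ * φ ψ δ}))
    (hm' : m' = IntermediateField.adjoin k
        ({ω : K | ω ∈ f.aroots K} ∪
          {s : K | ∃ ω ∈ f.aroots K, s ^ 2 = φ ω δ})) :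
    l ≤ m ∧ m ≤ m' ∧ IsGalois k ↥l ∧ IsGalois k ↥m ∧ IsGalois k ↥m' := by
  have : IsAlgClosed K := IsAlgClosure.isAlgClosed k
  have hf0 : f ≠ 0 := hsep.ne_zero
  obtain ⟨p, rfl⟩ := AdjoinRoot.mk_surjective δ
  have hval : ∀ ω ∈ f.aroots K, φ ω (AdjoinRoot.mk f p) = aeval ω p := by
    intro ω hω
    rw [← AdjoinRoot.aeval_eq, ← Polynomial.aeval_algHom_apply, hφ ω hω]
  have hne : ∀ ω, φ ω (AdjoinRoot.mk f p) ≠ 0 := fun ω => (hδ.map (φ ω)).ne_zero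
  have hroot : ∀ σ : K →ₐ[k] K, ∀ ω ∈ f.aroots K, σ ω ∈ f.aroots K := by
    intro σ ω hω
    rw [mem_aroots] at hω ⊢
    exact ⟨hf0, by rw [Polynomial.aeval_algHom_apply, hω.2, map_zero]⟩
  have hσ : ∀ σ : K →ₐ[k] K, ∀ ω ∈ f.aroots K,
      σ (φ ω (AdjoinRoot.mk f p)) = φ (σ ω) (AdjoinRoot.mk f p) := by
    intro σ ω hω
    rw [hval ω hω, hval _ (hroot σ ω hω), Polynomial.aeval_algHom_apply]
  have hsepω : ∀ ω ∈ f.aroots K, IsSeparable k ω := by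
    intro ω hω
    exact Separable.of_dvd hsep (minpoly.dvd _ _ (mem_aroots.1 hω).2)
  have hsepδ : ∀ ω ∈ f.aroots K, IsSeparable k (φ ω (AdjoinRoot.mk f p)) := by
    intro ω hω
    rw [hval ω hω, ← mem_separableClosure_iff]
    have h := Polynomial.aeval_algHom_apply (separableClosure k K).val
      ⟨ω, mem_separableClosure_iff.2 (hsepω ω hω)⟩ p
    have h' : aeval ω p = (separableClosure k K).val _ := h
    rw [h']
    exact Subtype.property _
  subst hl hm hm'
  refine ⟨IntermediateField.adjoin.mono _ _ _ Set.subset_union_left, ?_, ?_, ?_, ?_⟩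
  · rw [IntermediateField.adjoin_le_iff]
    rintro s (hs | ⟨ω, hω, ψ, hψ, hs⟩)
    · exact IntermediateField.subset_adjoin _ _ (Or.inl hs)
    · obtain ⟨t, ht⟩ := IsAlgClosed.exists_pow_nat_eq (φ ω (AdjoinRoot.mk f p)) two_pos
      obtain ⟨u, hu⟩ := IsAlgClosed.exists_pow_nat_eq (φ ψ (AdjoinRoot.mk f p)) two_pos
      have h1 := IntermediateField.subset_adjoin k ({ω : K | ω ∈ f.aroots K} ∪
          {s : K | ∃ ω ∈ f.aroots K, s ^ 2 = φ ω (AdjoinRoot.mk f p)}) (Or.inr ⟨ω, hω, ht⟩)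
      have h2 := IntermediateField.subset_adjoin k ({ω : K | ω ∈ f.aroots K} ∪
          {s : K | ∃ ω ∈ f.aroots K, s ^ 2 = φ ω (AdjoinRoot.mk f p)}) (Or.inr ⟨ψ, hψ, hu⟩)
      rw [← ht, ← hu, ← mul_pow, sq_eq_sq_iff_eq_or_eq_neg] at hs
      rcases hs with rfl | rfl
      · exact mul_mem h1 h2
      · exact neg_mem (mul_mem h1 h2)
  · exact aux_galois _ hsepω hroot
  · apply aux_galois
    · rintro s (hs | ⟨ω, hω, ψ, hψ, hs⟩)
      · exact hsepω s hs
      · refine aux_sqrt hchar _ s ?_ (mul_ne_zero (hne ω) (hne ψ)) hs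
        rw [← mem_separableClosure_iff]
        exact mul_mem (mem_separableClosure_iff.2 (hsepδ ω hω))
          (mem_separableClosure_iff.2 (hsepδ ψ hψ))
    · rintro σ s (hs | ⟨ω, hω, ψ, hψ, hs⟩)
      · exact Or.inl (hroot σ s hs)
      · refine Or.inr ⟨σ ω, hroot σ ω hω, σ ψ, hroot σ ψ hψ, ?_⟩
        rw [← map_pow, hs, map_mul, hσ σ ω hω, hσ σ ψ hψ]
  · apply aux_galois
    · rintro s (hs | ⟨ω, hω, hs⟩)
      · exact hsepω s hs
      · exact aux_sqrt hchar _ s (hsepδ ω hω) (hne ω) hs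
    · rintro σ s (hs | ⟨ω, hω, hs⟩)
      · exact Or.inl (hroot σ s hs)
      · refine Or.inr ⟨σ ω, hroot σ ω hω, ?_⟩
        rw [← map_pow, hs, hσ σ ω hω]
end

section
/- Let F be a field, and let ω₁, ω₂, ω₃, ω₄ ∈ F be pairwise distinct and all nonzero. Set c₁ = ω₁+ω₂+ω₃+ω₄, c₃ = ω₁ω₂ω₃+ω₁ω₂ω₄+ω₁ω₃ω₄+ω₂ω₃ω₄, c₄ = ω₁ω₂ω₃ω₄, and κ_j = ∏_{i≠j}(ω_j − ω_i) for 1 ≤ j ≤ 4. Then for all x₁, x₂, x₃, x₄ ∈ F: (∑_{j=1}^4 ω_j(2ω_j − c₁)κ_j⁻¹x_j)·(∑_{j=1}^4 ω_jκ_j⁻¹x_j) − (∑_{j=1}^4 κ_j⁻¹x_j)·(∑_{j=1}^4 (2c₄ω_j⁻¹ − c₃)κ_j⁻¹x_j) = ∑_{j=1}^4 κ_j⁻¹x_j². (This is the identity m₁l₂ − l₁m₂ = Q underlying the elliptic fibration of Lemma 2.36.) -/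
/-- Let `F` be a field and `ω₁, ω₂, ω₃, ω₄ ∈ F` pairwise distinct and
nonzero.  With `c₁, c₃, c₄` the elementary symmetric functions of degrees `1, 3, 4` and
`κ_j = ∏_{i≠j}(ω_j − ω_i)`, for all `x₁,…,x₄ ∈ F`:
`(∑ ω_j(2ω_j−c₁)κ_j⁻¹x_j)(∑ ω_jκ_j⁻¹x_j) − (∑ κ_j⁻¹x_j)(∑ (2c₄ω_j⁻¹−c₃)κ_j⁻¹x_j)
  = ∑ κ_j⁻¹x_j²`  (the identity `m₁l₂ − l₁m₂ = Q`). -/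
theorem statement14 {F : Type*} [Field F] (ω1 ω2 ω3 ω4 : F)
    (h12 : ω1 ≠ ω2) (h13 : ω1 ≠ ω3) (h14 : ω1 ≠ ω4)
    (h23 : ω2 ≠ ω3) (h24 : ω2 ≠ ω4) (h34 : ω3 ≠ ω4)
    (hn1 : ω1 ≠ 0) (hn2 : ω2 ≠ 0) (hn3 : ω3 ≠ 0) (hn4 : ω4 ≠ 0)
    (c1 c3 c4 κ1 κ2 κ3 κ4 : F)
    (hc1 : c1 = ω1 + ω2 + ω3 + ω4)
    (hc3 : c3 = ω1 * ω2 * ω3 + ω1 * ω2 * ω4 + ω1 * ω3 * ω4 + ω2 * ω3 * ω4)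
    (hc4 : c4 = ω1 * ω2 * ω3 * ω4)
    (hκ1 : κ1 = (ω1 - ω2) * (ω1 - ω3) * (ω1 - ω4))
    (hκ2 : κ2 = (ω2 - ω1) * (ω2 - ω3) * (ω2 - ω4))
    (hκ3 : κ3 = (ω3 - ω1) * (ω3 - ω2) * (ω3 - ω4))
    (hκ4 : κ4 = (ω4 - ω1) * (ω4 - ω2) * (ω4 - ω3))
    (x1 x2 x3 x4 : F) :
    (ω1 * (2 * ω1 - c1) * κ1⁻¹ * x1 + ω2 * (2 * ω2 - c1) * κ2⁻¹ * x2
        + ω3 * (2 * ω3 - c1) * κ3⁻¹ * x3 + ω4 * (2 * ω4 - c1) * κ4⁻¹ * x4)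
      * (ω1 * κ1⁻¹ * x1 + ω2 * κ2⁻¹ * x2 + ω3 * κ3⁻¹ * x3 + ω4 * κ4⁻¹ * x4)
    - (κ1⁻¹ * x1 + κ2⁻¹ * x2 + κ3⁻¹ * x3 + κ4⁻¹ * x4)
      * ((2 * c4 * ω1⁻¹ - c3) * κ1⁻¹ * x1 + (2 * c4 * ω2⁻¹ - c3) * κ2⁻¹ * x2
        + (2 * c4 * ω3⁻¹ - c3) * κ3⁻¹ * x3 + (2 * c4 * ω4⁻¹ - c3) * κ4⁻¹ * x4)
    = κ1⁻¹ * x1 ^ 2 + κ2⁻¹ * x2 ^ 2 + κ3⁻¹ * x3 ^ 2 + κ4⁻¹ * x4 ^ 2 := by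
  have k1 : κ1 ≠ 0 := by
    rw [hκ1]
    exact mul_ne_zero (mul_ne_zero (sub_ne_zero.mpr h12) (sub_ne_zero.mpr h13)) (sub_ne_zero.mpr h14)
  have w1 : 2 * c4 * ω1⁻¹ = 2 * (ω2 * ω3 * ω4) := by
    rw [hc4]
    field_simp
  obtain ⟨y1, hy1⟩ : ∃ y, x1 = κ1 * y := ⟨κ1⁻¹ * x1, by field_simp⟩
  have e1 : κ1⁻¹ * x1 = y1 := by
    rw [hy1, inv_mul_cancel_left₀ k1]
  have k2 : κ2 ≠ 0 := by
    rw [hκ2]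
    exact mul_ne_zero (mul_ne_zero (sub_ne_zero.mpr h12.symm) (sub_ne_zero.mpr h23)) (sub_ne_zero.mpr h24)
  have w2 : 2 * c4 * ω2⁻¹ = 2 * (ω1 * ω3 * ω4) := by
    rw [hc4]
    field_simp
  obtain ⟨y2, hy2⟩ : ∃ y, x2 = κ2 * y := ⟨κ2⁻¹ * x2, by field_simp⟩
  have e2 : κ2⁻¹ * x2 = y2 := by
    rw [hy2, inv_mul_cancel_left₀ k2]
  have k3 : κ3 ≠ 0 := by
    rw [hκ3]
    exact mul_ne_zero (mul_ne_zero (sub_ne_zero.mpr h13.symm) (sub_ne_zero.mpr h23.symm)) (sub_ne_zero.mpr h34)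
  have w3 : 2 * c4 * ω3⁻¹ = 2 * (ω1 * ω2 * ω4) := by
    rw [hc4]
    field_simp
  obtain ⟨y3, hy3⟩ : ∃ y, x3 = κ3 * y := ⟨κ3⁻¹ * x3, by field_simp⟩
  have e3 : κ3⁻¹ * x3 = y3 := by
    rw [hy3, inv_mul_cancel_left₀ k3]
  have k4 : κ4 ≠ 0 := by
    rw [hκ4]
    exact mul_ne_zero (mul_ne_zero (sub_ne_zero.mpr h14.symm) (sub_ne_zero.mpr h24.symm)) (sub_ne_zero.mpr h34.symm)
  have w4 : 2 * c4 * ω4⁻¹ = 2 * (ω1 * ω2 * ω3) := by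
    rw [hc4]
    field_simp
  obtain ⟨y4, hy4⟩ : ∃ y, x4 = κ4 * y := ⟨κ4⁻¹ * x4, by field_simp⟩
  have e4 : κ4⁻¹ * x4 = y4 := by
    rw [hy4, inv_mul_cancel_left₀ k4]
  rw [w1, w2, w3, w4]
  simp only [pow_two, ← mul_assoc (κ1⁻¹) x1, ← mul_assoc (κ2⁻¹) x2, ← mul_assoc (κ3⁻¹) x3, ← mul_assoc (κ4⁻¹) x4,
    mul_assoc _ (κ1⁻¹) x1, mul_assoc _ (κ2⁻¹) x2, mul_assoc _ (κ3⁻¹) x3, mul_assoc _ (κ4⁻¹) x4, e1, e2, e3, e4]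
  rw [hy1, hy2, hy3, hy4, hc1, hc3, hκ1, hκ2, hκ3, hκ4]
  ring
end

section
/- Let F be a field of characteristic ≠ 2, let ω₁, ω₂, ω₃, ω₄ ∈ F be pairwise distinct and all nonzero, and let e₁, e₂, e₃, e₄, φ₁, φ₂, φ₃, φ₄ ∈ F be such that β₁ = e₁e₄+e₂e₃, β₂ = e₁e₃+e₂e₄ and β₃ = e₁e₂+e₃e₄ are all nonzero. Set c₁ = ∑ω_j, c₃ = ∑_{i<j<k}ω_iω_jω_k, c₄ = ∏ω_j, κ_j = ∏_{i≠j}(ω_j−ω_i), α₁ = ω₁ω₄+ω₂ω₃, α₂ = ω₁ω₃+ω₂ω₄, α₃ = ω₁ω₂+ω₃ω₄, γ₁ = α₃−α₂, γ₂ = α₁−α₃, γ₃ = α₂−α₁, b₁ = ω₁+ω₂−ω₃−ω₄, b₂ = −c₄(ω₁⁻¹+ω₂⁻¹−ω₃⁻¹−ω₄⁻¹), and Q = ∑_{j=1}^4 κ_j⁻¹e_j²φ_j². For i = 1, 2 define l₁ = ∑ κ_j⁻¹e_jφ_j, l₂ = ∑ ω_jκ_j⁻¹e_jφ_j, m₁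 = ∑ ω_j(2ω_j−c₁)κ_j⁻¹e_jφ_j, m₂ = ∑ (2c₄ω_j⁻¹−c₃)κ_j⁻¹e_jφ_j, and let τl_i, τm_i denote the same expressions with e₁, e₂ replaced by −e₁, −e₂. Set u_i = β₁⁻¹(τl_i·m_i + τm_i·l_i + 2α₁·l_i·τl_i), v_i = β₂⁻¹(τl_i·m_i + τm_i·l_i + 2α₂·l_i·τl_i), w_i = β₃⁻¹(τl_i·m_i − τm_i·l_i). Then for i = 1 and i = 2: γ₁β₁²u_i² + γ₂β₂²v_i² + γ₃β₃²w_i² = 4γ₃·b_i·(τl_i)·l_i·Q. -/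
/-- The algebraic identity underlying Lemma 2.38: with `ω₁,…,ω₄` pairwise
distinct and nonzero, `e₁,…,e₄, y₁,…,y₄` arbitrary with `β₁, β₂, β₃` nonzero, and all derived
quantities as in the paper, one has
`γ₁β₁²u_i² + γ₂β₂²v_i² + γ₃β₃²w_i² = 4γ₃·b_i·(τl_i)·l_i·Q` for `i = 1, 2`. -/
theorem statement15 {F : Type*} [Field F] (hchar : (2 : F) ≠ 0)
    (ω1 ω2 ω3 ω4 : F)
    (h12 : ω1 ≠ ω2) (h13 : ω1 ≠ ω3) (h14 : ω1 ≠ ω4)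
    (h23 : ω2 ≠ ω3) (h24 : ω2 ≠ ω4) (h34 : ω3 ≠ ω4)
    (hn1 : ω1 ≠ 0) (hn2 : ω2 ≠ 0) (hn3 : ω3 ≠ 0) (hn4 : ω4 ≠ 0)
    (e1 e2 e3 e4 y1 y2 y3 y4 : F)
    (β1 β2 β3 : F)
    (hβ1 : β1 = e1 * e4 + e2 * e3) (hβ2 : β2 = e1 * e3 + e2 * e4)
    (hβ3 : β3 = e1 * e2 + e3 * e4)
    (hβ1ne : β1 ≠ 0) (hβ2ne : β2 ≠ 0) (hβ3ne : β3 ≠ 0)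
    (c1 c3 c4 κ1 κ2 κ3 κ4 α1 α2 α3 γ1 γ2 γ3 b1 b2 Q : F)
    (hc1 : c1 = ω1 + ω2 + ω3 + ω4)
    (hc3 : c3 = ω1 * ω2 * ω3 + ω1 * ω2 * ω4 + ω1 * ω3 * ω4 + ω2 * ω3 * ω4)
    (hc4 : c4 = ω1 * ω2 * ω3 * ω4)
    (hκ1 : κ1 = (ω1 - ω2) * (ω1 - ω3) * (ω1 - ω4))
    (hκ2 : κ2 = (ω2 - ω1) * (ω2 - ω3) * (ω2 - ω4))
    (hκ3 : κ3 = (ω3 - ω1) * (ω3 - ω2) * (ω3 - ω4))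
    (hκ4 : κ4 = (ω4 - ω1) * (ω4 - ω2) * (ω4 - ω3))
    (hα1 : α1 = ω1 * ω4 + ω2 * ω3) (hα2 : α2 = ω1 * ω3 + ω2 * ω4)
    (hα3 : α3 = ω1 * ω2 + ω3 * ω4)
    (hγ1 : γ1 = α3 - α2) (hγ2 : γ2 = α1 - α3) (hγ3 : γ3 = α2 - α1)
    (hb1 : b1 = ω1 + ω2 - ω3 - ω4)
    (hb2 : b2 = -c4 * (ω1⁻¹ + ω2⁻¹ - ω3⁻¹ - ω4⁻¹))
    (hQ : Q = κ1⁻¹ * e1 ^ 2 * y1 ^ 2 + κ2⁻¹ * e2 ^ 2 * y2 ^ 2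
        + κ3⁻¹ * e3 ^ 2 * y3 ^ 2 + κ4⁻¹ * e4 ^ 2 * y4 ^ 2)
    (l1 l2 m1 m2 tl1 tl2 tm1 tm2 : F)
    (hl1 : l1 = κ1⁻¹ * e1 * y1 + κ2⁻¹ * e2 * y2 + κ3⁻¹ * e3 * y3 + κ4⁻¹ * e4 * y4)
    (hl2 : l2 = ω1 * κ1⁻¹ * e1 * y1 + ω2 * κ2⁻¹ * e2 * y2
        + ω3 * κ3⁻¹ * e3 * y3 + ω4 * κ4⁻¹ * e4 * y4)
    (hm1 : m1 = ω1 * (2 * ω1 - c1) * κ1⁻¹ * e1 * y1 + ω2 * (2 * ω2 - c1) * κ2⁻¹ * e2 * y2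
        + ω3 * (2 * ω3 - c1) * κ3⁻¹ * e3 * y3 + ω4 * (2 * ω4 - c1) * κ4⁻¹ * e4 * y4)
    (hm2 : m2 = (2 * c4 * ω1⁻¹ - c3) * κ1⁻¹ * e1 * y1 + (2 * c4 * ω2⁻¹ - c3) * κ2⁻¹ * e2 * y2
        + (2 * c4 * ω3⁻¹ - c3) * κ3⁻¹ * e3 * y3 + (2 * c4 * ω4⁻¹ - c3) * κ4⁻¹ * e4 * y4)
    (htl1 : tl1 = κ1⁻¹ * (-e1) * y1 + κ2⁻¹ * (-e2) * y2 + κ3⁻¹ * e3 * y3 + κ4⁻¹ * e4 * y4)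
    (htl2 : tl2 = ω1 * κ1⁻¹ * (-e1) * y1 + ω2 * κ2⁻¹ * (-e2) * y2
        + ω3 * κ3⁻¹ * e3 * y3 + ω4 * κ4⁻¹ * e4 * y4)
    (htm1 : tm1 = ω1 * (2 * ω1 - c1) * κ1⁻¹ * (-e1) * y1
        + ω2 * (2 * ω2 - c1) * κ2⁻¹ * (-e2) * y2
        + ω3 * (2 * ω3 - c1) * κ3⁻¹ * e3 * y3 + ω4 * (2 * ω4 - c1) * κ4⁻¹ * e4 * y4)
    (htm2 : tm2 = (2 * c4 * ω1⁻¹ - c3) * κ1⁻¹ * (-e1) * y1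
        + (2 * c4 * ω2⁻¹ - c3) * κ2⁻¹ * (-e2) * y2
        + (2 * c4 * ω3⁻¹ - c3) * κ3⁻¹ * e3 * y3 + (2 * c4 * ω4⁻¹ - c3) * κ4⁻¹ * e4 * y4)
    (u1 v1 w1 u2 v2 w2 : F)
    (hu1 : u1 = β1⁻¹ * (tl1 * m1 + tm1 * l1 + 2 * α1 * l1 * tl1))
    (hv1 : v1 = β2⁻¹ * (tl1 * m1 + tm1 * l1 + 2 * α2 * l1 * tl1))
    (hw1 : w1 = β3⁻¹ * (tl1 * m1 - tm1 * l1))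
    (hu2 : u2 = β1⁻¹ * (tl2 * m2 + tm2 * l2 + 2 * α1 * l2 * tl2))
    (hv2 : v2 = β2⁻¹ * (tl2 * m2 + tm2 * l2 + 2 * α2 * l2 * tl2))
    (hw2 : w2 = β3⁻¹ * (tl2 * m2 - tm2 * l2)) :
    γ1 * β1 ^ 2 * u1 ^ 2 + γ2 * β2 ^ 2 * v1 ^ 2 + γ3 * β3 ^ 2 * w1 ^ 2
        = 4 * γ3 * b1 * tl1 * l1 * Q ∧
    γ1 * β1 ^ 2 * u2 ^ 2 + γ2 * β2 ^ 2 * v2 ^ 2 + γ3 * β3 ^ 2 * w2 ^ 2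
        = 4 * γ3 * b2 * tl2 * l2 * Q := by
  have k1 : κ1 ≠ 0 := by
    rw [hκ1]
    exact mul_ne_zero (mul_ne_zero (sub_ne_zero.2 h12) (sub_ne_zero.2 h13)) (sub_ne_zero.2 h14)
  have k2 : κ2 ≠ 0 := by
    rw [hκ2]
    exact mul_ne_zero (mul_ne_zero (sub_ne_zero.2 h12.symm) (sub_ne_zero.2 h23))
      (sub_ne_zero.2 h24)
  have k3 : κ3 ≠ 0 := by
    rw [hκ3]
    exact mul_ne_zero (mul_ne_zero (sub_ne_zero.2 h13.symm) (sub_ne_zero.2 h23.symm))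
      (sub_ne_zero.2 h34)
  have k4 : κ4 ≠ 0 := by
    rw [hκ4]
    exact mul_ne_zero (mul_ne_zero (sub_ne_zero.2 h14.symm) (sub_ne_zero.2 h24.symm))
      (sub_ne_zero.2 h34.symm)
  obtain ⟨z1, hz1⟩ : ∃ z, z = κ1⁻¹ * e1 * y1 := ⟨_, rfl⟩
  obtain ⟨z2, hz2⟩ : ∃ z, z = κ2⁻¹ * e2 * y2 := ⟨_, rfl⟩
  obtain ⟨z3, hz3⟩ : ∃ z, z = κ3⁻¹ * e3 * y3 := ⟨_, rfl⟩
  obtain ⟨z4, hz4⟩ : ∃ z, z = κ4⁻¹ * e4 * y4 := ⟨_, rfl⟩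
  have Q' : Q = κ1 * z1 ^ 2 + κ2 * z2 ^ 2 + κ3 * z3 ^ 2 + κ4 * z4 ^ 2 := by
    rw [hQ, hz1, hz2, hz3, hz4]; field_simp
  have i1 : c4 * ω1⁻¹ = ω2 * ω3 * ω4 := by rw [hc4]; field_simp
  have i2 : c4 * ω2⁻¹ = ω1 * ω3 * ω4 := by rw [hc4]; field_simp
  have i3 : c4 * ω3⁻¹ = ω1 * ω2 * ω4 := by rw [hc4]; field_simp
  have i4 : c4 * ω4⁻¹ = ω1 * ω2 * ω3 := by rw [hc4]; field_simp
  have b2' : b2 = -(ω2 * ω3 * ω4 + ω1 * ω3 * ω4 - ω1 * ω2 * ω4 - ω1 * ω2 * ω3) := by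
    rw [hb2, ← i1, ← i2, ← i3, ← i4]; ring
  have key1 : -(m1 * tm1) - α3 * (tl1 * m1 + tm1 * l1)
      + l1 * tl1 * (α1 * α2 - α3 * α1 - α3 * α2) = b1 * Q := by
    have a1 : l1 = (z1 + z2) + (z3 + z4) := by rw [hl1, hz1, hz2, hz3, hz4]; ring
    have a2 : tl1 = -(z1 + z2) + (z3 + z4) := by rw [htl1, hz1, hz2, hz3, hz4]; ring
    have a3 : m1 = ω1 * (2 * ω1 - c1) * z1 + ω2 * (2 * ω2 - c1) * z2
        + ω3 * (2 * ω3 - c1) * z3 + ω4 * (2 * ω4 - c1) * z4 := by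
      rw [hm1, hz1, hz2, hz3, hz4]; ring
    have a4 : tm1 = -(ω1 * (2 * ω1 - c1) * z1) - ω2 * (2 * ω2 - c1) * z2
        + ω3 * (2 * ω3 - c1) * z3 + ω4 * (2 * ω4 - c1) * z4 := by
      rw [htm1, hz1, hz2, hz3, hz4]; ring
    rw [a1, a2, a3, a4, Q', hb1, hα1, hα2, hα3, hκ1, hκ2, hκ3, hκ4, hc1]
    ring
  have key2 : -(m2 * tm2) - α3 * (tl2 * m2 + tm2 * l2)
      + l2 * tl2 * (α1 * α2 - α3 * α1 - α3 * α2) = b2 * Q := by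
    have a1 : l2 = ω1 * z1 + ω2 * z2 + ω3 * z3 + ω4 * z4 := by
      rw [hl2, hz1, hz2, hz3, hz4]; ring
    have a2 : tl2 = -(ω1 * z1) - ω2 * z2 + ω3 * z3 + ω4 * z4 := by
      rw [htl2, hz1, hz2, hz3, hz4]; ring
    have a3 : m2 = (2 * (ω2 * ω3 * ω4) - c3) * z1 + (2 * (ω1 * ω3 * ω4) - c3) * z2
        + (2 * (ω1 * ω2 * ω4) - c3) * z3 + (2 * (ω1 * ω2 * ω3) - c3) * z4 := by
      rw [hm2, ← i1, ← i2, ← i3, ← i4, hz1, hz2, hz3, hz4]; ring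
    have a4 : tm2 = -((2 * (ω2 * ω3 * ω4) - c3) * z1) - (2 * (ω1 * ω3 * ω4) - c3) * z2
        + (2 * (ω1 * ω2 * ω4) - c3) * z3 + (2 * (ω1 * ω2 * ω3) - c3) * z4 := by
      rw [htm2, ← i1, ← i2, ← i3, ← i4, hz1, hz2, hz3, hz4]; ring
    rw [a1, a2, a3, a4, Q', b2', hα1, hα2, hα3, hκ1, hκ2, hκ3, hκ4, hc3]
    ring
  have sq : ∀ β x : F, β ≠ 0 → β ^ 2 * (β⁻¹ * x) ^ 2 = x ^ 2 := by
    intro β x h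
    field_simp
  constructor
  · rw [hu1, hv1, hw1, mul_assoc γ1, mul_assoc γ2, mul_assoc γ3, sq _ _ hβ1ne, sq _ _ hβ2ne,
      sq _ _ hβ3ne, hγ1, hγ2, hγ3]
    linear_combination 4 * (α2 - α1) * tl1 * l1 * key1
  · rw [hu2, hv2, hw2, mul_assoc γ1, mul_assoc γ2, mul_assoc γ3, sq _ _ hβ1ne, sq _ _ hβ2ne,
      sq _ _ hβ3ne, hγ1, hγ2, hγ3]
    linear_combination 4 * (α2 - α1) * tl2 * l2 * key2
end

section
/- The only solution (x₁,…,x₆) ∈ ℚ⁶ of the system q₁ = q₂ = q₃ = 0 is (0,0,0,0,0,0); equivalently, the projective surface V ⊂ ℙ⁵_ℚ defined by q₁ = q₂ = q₃ = 0 has no ℚ-rational points. -/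
/-- 2-adic analysis. -/
lemma two_adic (u v p q g h : ℤ)
    (e1 : p^2 + 2*q^2 = 3*(u^2 - 2*u*v - v^2))
    (e2 : h^2 + 2*g*h + 2*p*q = 0)
    (e3 : 2*g^2 + 2*h^2 - 2*p*q = 3*(u^2 + 4*u*v - v^2))
    (hn : ¬ (2 ∣ u ∧ 2 ∣ v ∧ 2 ∣ p ∧ 2 ∣ q ∧ 2 ∣ g ∧ 2 ∣ h)) :
    ∃ k P : ℤ, h = 2*k ∧ p = 2*P ∧ Odd k ∧ Odd P := by
  have h2 : Prime (2:ℤ) := Int.prime_two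
  have hh : (2:ℤ) ∣ h := h2.dvd_of_dvd_pow (n := 2) ⟨-(g*h + p*q), by linear_combination e2⟩
  obtain ⟨k, rfl⟩ := hh
  have huv : (2:ℤ) ∣ u - v := by
    apply h2.dvd_of_dvd_pow (n := 2)
    refine ⟨g^2 + (2*k)^2 - p*q - (u^2 - v^2) - 6*u*v - u*v + v^2, ?_⟩
    linear_combination -e3
  obtain ⟨c, hc⟩ := huv
  obtain rfl : u = v + 2*c := by linarith
  have hp : (2:ℤ) ∣ p := by
    apply h2.dvd_of_dvd_pow (n := 2)
    refine ⟨-q^2 + 3*(2*v*c + 2*c^2 - v^2 - 2*c*v), ?_⟩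
    linear_combination e1
  obtain ⟨P, rfl⟩ := hp
  have hv : ¬ (2:ℤ) ∣ v := by
    rintro ⟨b, rfl⟩
    have hq : (2:ℤ) ∣ q := by
      apply h2.dvd_of_dvd_pow (n := 2)
      refine ⟨-P^2 + 3*((b+c)^2 - 2*(b+c)*b - b^2), ?_⟩
      linarith [e1]
    obtain ⟨r, rfl⟩ := hq
    have hg : (2:ℤ) ∣ g := by
      apply h2.dvd_of_dvd_pow (n := 2)
      refine ⟨-2*k^2 + 2*P*r + 3*((b+c)^2 + 4*(b+c)*b - b^2), ?_⟩
      linarith [e3]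
    exact hn ⟨⟨b + c, by ring⟩, ⟨b, rfl⟩, ⟨P, rfl⟩, ⟨r, rfl⟩, hg, ⟨k, rfl⟩⟩
  have hv' : Odd v := by
    rw [← Int.not_even_iff_odd, even_iff_two_dvd]; exact hv
  obtain ⟨b, rfl⟩ := hv'
  have hg : (2:ℤ) ∣ g := by
    apply h2.dvd_of_dvd_pow (n := 2)
    refine ⟨-2*k^2 + P*q + 3*((2*b+1)^2 + 3*c*(2*b+1) + c^2), ?_⟩
    linarith [e3]
  obtain ⟨G, rfl⟩ := hg
  have hPq : Odd (P*q) := by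
    obtain ⟨w, hw⟩ := Int.even_mul_succ_self c
    refine ⟨G^2 + k^2 - 2 - 3*(2*b^2 + 2*b + 3*b*c + c) - 3*w, ?_⟩
    linarith [e3, hw]
  have hP : Odd P := (Int.odd_mul.mp hPq).1
  have hk : Odd (k*(k+2*G)) := by
    have : k*(k+2*G) = -(P*q) := by linarith [e2]
    rw [this]; exact hPq.neg
  exact ⟨k, P, rfl, rfl, (Int.odd_mul.mp hk).1, hP⟩

/-- 3-adic analysis -/
lemma mod9 : ∀ p q g h : ZMod 9, 3*(p^2+2*q^2) = 0 → p^2 + 2*q^2 = 2*g^2+2*h^2-2*p*q →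
   h^2+2*g*h+2*p*q = 0 → (h^2 - p^2 = 6 ∨ (3*p = 0 ∧ 3*q=0 ∧ 3*g=0 ∧ 3*h=0)) := by
  decide +kernel
lemma mod5 : ∀ u v q : ZMod 5, 2*q^2 = 3*(u^2 - 2*u*v - v^2) → 0 = (u^2 + 4*u*v - v^2) → u = 0 ∧ v = 0 ∧ q = 0 := by
  decide +kernel
lemma mod3 : ∀ u v : ZMod 3, u^2 - 2*u*v-v^2 = 0 → u = 0 ∧ v = 0 := by decide

lemma desc (l : ℕ) [Fact l.Prime] (T c : ℤ) (hc : ¬ (l:ℤ) ∣ c) : ∀ (n : ℕ) (d x y : ℤ), d.natAbs = n → d ≠ 0 →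
    T*d^2 = x^2 - l*c*y^2 → IsSquare (T : ZMod l) := by
  intro n
  induction n using Nat.strong_induction_on with
  | _ n ih =>
    intro d x y hdn hd he
    have hl : Prime (l:ℤ) := Nat.prime_iff_prime_int.mp Fact.out
    have hl1 : 1 < l := (Fact.out : l.Prime).one_lt
    by_cases hdl : (l:ℤ) ∣ d
    · obtain ⟨d', rfl⟩ := hdl
      have hx : (l:ℤ) ∣ x := hl.dvd_of_dvd_pow (n := 2) ⟨T*l*d'^2 + c*y^2, by linear_combination -he⟩
      obtain ⟨x', rfl⟩ := hx
      have hl0 : (l:ℤ) ≠ 0 := hl.ne_zero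
      have h1 : (l:ℤ) * (T*d'^2) = l*x'^2 - c*y^2 := by
        apply mul_left_cancel₀ hl0; linear_combination he
      have hy : (l:ℤ) ∣ y := by
        have : (l:ℤ) ∣ c*y^2 := ⟨x'^2 - T*d'^2, by linear_combination h1⟩
        exact hl.dvd_of_dvd_pow ((hl.dvd_or_dvd this).resolve_left hc)
      obtain ⟨y', rfl⟩ := hy
      have hd' : d' ≠ 0 := by rintro rfl; simp at hd
      refine ih d'.natAbs ?_ d' x' y' rfl hd' ?_
      · rw [← hdn, Int.natAbs_mul, Int.natAbs_natCast]
        have := Int.natAbs_pos.mpr hd'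
        nlinarith
      · apply mul_left_cancel₀ hl0; linear_combination h1
    · have hd0 : (d : ZMod l) ≠ 0 := by
        rw [Ne, ZMod.intCast_zmod_eq_zero_iff_dvd]; exact hdl
      have he' := congrArg (Int.cast : ℤ → ZMod l) he
      push_cast at he'
      simp only [CharP.cast_eq_zero, zero_mul, sub_zero] at he'
      refine ⟨x / d, ?_⟩
      field_simp
      exact he'

lemma jac (S : ℤ) (c : ℕ) (hc : c ≠ 0) (H : ∀ l : ℕ, (hl : l.Prime) → l ∣ c → jacobiSym S l = 1) : jacobiSym S c = 1 := by
  induction c using Nat.recOnMul with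
  | zero => exact absurd rfl hc
  | one => simp
  | prime p hp => exact H p hp dvd_rfl
  | mul a b iha ihb =>
    have ha : a ≠ 0 := left_ne_zero_of_mul hc
    have hb : b ≠ 0 := right_ne_zero_of_mul hc
    have : NeZero a := ⟨ha⟩
    have : NeZero b := ⟨hb⟩
    rw [jacobiSym.mul_right, iha ha fun l hl h => H l hl (h.mul_right _), ihb hb fun l hl h => H l hl (h.mul_left _), one_mul]

lemma three_adic (u v p q g h : ℤ)
    (e1 : p^2 + 2*q^2 = 3*(u^2 - 2*u*v - v^2))
    (e2 : h^2 + 2*g*h + 2*p*q = 0)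
    (e3 : 2*g^2 + 2*h^2 - 2*p*q = 3*(u^2 + 4*u*v - v^2))
    (hn : ¬ (3 ∣ u ∧ 3 ∣ v ∧ 3 ∣ p ∧ 3 ∣ q ∧ 3 ∣ g ∧ 3 ∣ h)) :
    (9:ℤ) ∣ h^2 - p^2 - 6 := by
  have a1 : (((3*(p^2+2*q^2) : ℤ)) : ZMod 9) = 0 := by
    rw [ZMod.intCast_zmod_eq_zero_iff_dvd]
    exact ⟨u^2 - 2*u*v - v^2, by push_cast; linear_combination 3*e1⟩
  have a2 : (((p^2 + 2*q^2 - (2*g^2+2*h^2-2*p*q) : ℤ)) : ZMod 9) = 0 := by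
    rw [ZMod.intCast_zmod_eq_zero_iff_dvd]
    exact ⟨-2*u*v, by push_cast; linear_combination e1 - e3⟩
  have a3 := congrArg (Int.cast : ℤ → ZMod 9) e2
  push_cast at a1 a2 a3
  rcases mod9 p q g h a1 (sub_eq_zero.mp a2) a3 with H | ⟨b1, b2, b3, b4⟩
  · have : (((h^2 - p^2 - 6 : ℤ)) : ZMod 9) = 0 := by
      push_cast; rw [H]; decide
    rw [ZMod.intCast_zmod_eq_zero_iff_dvd] at this
    exact_mod_cast this
  · exfalso
    have key : ∀ z : ℤ, (3 * (z : ZMod 9)) = 0 → (3:ℤ) ∣ z := by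
      intro z hz
      have : (((3*z : ℤ)) : ZMod 9) = 0 := by push_cast; exact hz
      rw [ZMod.intCast_zmod_eq_zero_iff_dvd] at this
      push_cast at this
      omega
    obtain ⟨p', rfl⟩ := key p b1
    obtain ⟨q', rfl⟩ := key q b2
    have : (((u^2 - 2*u*v - v^2 : ℤ)) : ZMod 3) = 0 := by
      rw [ZMod.intCast_zmod_eq_zero_iff_dvd]
      exact ⟨p'^2 + 2*q'^2, by push_cast; linarith [e1]⟩
    push_cast at this
    obtain ⟨c1, c2⟩ := mod3 u v this
    rw [ZMod.intCast_zmod_eq_zero_iff_dvd] at c1 c2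
    exact hn ⟨by exact_mod_cast c1, by exact_mod_cast c2, ⟨_, rfl⟩, ⟨_, rfl⟩, key g b3, key h b4⟩

lemma five_adic (u v q g h0 p0 d : ℤ)
    (e1 : (d*p0)^2 + 2*q^2 = 3*(u^2 - 2*u*v - v^2))
    (e2 : (d*h0)^2 + 2*g*(d*h0) + 2*(d*p0)*q = 0)
    (e3 : 2*g^2 + 2*(d*h0)^2 - 2*(d*p0)*q = 3*(u^2 + 4*u*v - v^2)) (hd : d ≠ 0)
    (hcop : IsCoprime h0 p0)
    (hn : ¬ (5 ∣ u ∧ 5 ∣ v ∧ 5 ∣ (d*p0) ∧ 5 ∣ q ∧ 5 ∣ g ∧ 5 ∣ (d*h0))) :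
    ¬ (5:ℤ) ∣ p0 := by
  rintro ⟨r, rfl⟩
  have h5 : Prime (5:ℤ) := by norm_num
  have hh0 : ¬ (5:ℤ) ∣ h0 := by
    intro hh
    have := hcop.isUnit_of_dvd' hh (Dvd.intro _ rfl)
    exact h5.not_isUnit this
  have f2 : h0*(d*h0 + 2*g) = -(10*r*q) := by
    apply mul_left_cancel₀ hd; linear_combination e2
  have h51 : (5:ℤ) ∣ d*h0 + 2*g :=
    (h5.dvd_or_dvd (⟨-(2*r*q), by linear_combination f2⟩ : (5:ℤ) ∣ h0*(d*h0 + 2*g))).resolve_left hh0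
  obtain ⟨w, hw⟩ := h51
  have hH : d*h0 = 5*w - 2*g := by linarith
  have a1 : (((2*q^2 - 3*(u^2 - 2*u*v - v^2) : ℤ)) : ZMod 5) = 0 := by
    rw [ZMod.intCast_zmod_eq_zero_iff_dvd]
    exact ⟨-5*d^2*r^2, by push_cast; linear_combination e1⟩
  have a2 : ((((u^2 + 4*u*v - v^2) : ℤ)) : ZMod 5) = 0 := by
    rw [ZMod.intCast_zmod_eq_zero_iff_dvd]
    refine ⟨2*(2*g^2 + 10*w^2 - 8*w*g - 2*d*r*q) - (u^2+4*u*v-v^2), ?_⟩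
    push_cast; rw [hH] at e3; linear_combination -2*e3
  push_cast at a1 a2
  obtain ⟨c1, c2, c3⟩ := mod5 u v q (sub_eq_zero.mp a1) a2.symm
  rw [ZMod.intCast_zmod_eq_zero_iff_dvd] at c1 c2 c3
  push_cast at c1 c2 c3
  obtain ⟨u, rfl⟩ := c1
  obtain ⟨v, rfl⟩ := c2
  obtain ⟨q, rfl⟩ := c3
  have h52 : (5:ℤ) ∣ w := by
    have : (5:ℤ) ∣ h0*w := by
      rw [hw] at f2
      exact ⟨-(2*r*q), by linarith⟩
    exact (h5.dvd_or_dvd this).resolve_left hh0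
  obtain ⟨w, rfl⟩ := h52
  have hg : (5:ℤ) ∣ g := by
    have : (5:ℤ) ∣ 2*g^2 := by
      rw [hH] at e3
      refine ⟨-(50*w^2) + 8*w*g + 2*d*r*q  + 3*(u^2+4*u*v-v^2), ?_⟩
      linarith
    exact h5.dvd_of_dvd_pow ((h5.dvd_or_dvd this).resolve_left (by norm_num))
  exact hn ⟨⟨_, rfl⟩, ⟨_, rfl⟩, ⟨d*r, by ring⟩, ⟨_, rfl⟩, hg, by rw [hH]; omega⟩

lemma odd_sq_mod8 (a : ℤ) (ha : Odd a) : a^2 % 8 = 1 := by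
  obtain ⟨r, rfl⟩ := ha
  obtain ⟨w, hw⟩ := Int.even_mul_succ_self r
  have : (2*r+1)^2 = 8*w + 1 := by linear_combination 4*hw
  omega

lemma final (h0 p0 e d x y : ℤ) (hd : d ≠ 0) (he : h0^2 = p0^2 + 3*e) (he3 : e % 3 = 2)
    (hh : Odd h0) (hp : Odd p0) (h5 : ¬ (5:ℤ) ∣ p0) (hcop : IsCoprime h0 p0)
    (hT : (6*(h0^2-p0^2)*(5*h0^4-2*p0^4))*d^2 = x^2 - ((p0^2)^2 + 4*p0^2*e + 5*e^2)*y^2) : False := by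
  have hp8 : p0^2 % 8 = 1 := odd_sq_mod8 _ hp
  have hh8 : h0^2 % 8 = 1 := odd_sq_mod8 _ hh
  obtain ⟨f, hf⟩ : ∃ f : ℕ, (f:ℤ) = (p0^2)^2 + 4*p0^2*e + 5*e^2 :=
    ⟨((p0^2)^2 + 4*p0^2*e + 5*e^2).toNat, Int.toNat_of_nonneg (by nlinarith [sq_nonneg (p0^2+2*e), sq_nonneg e])⟩
  obtain ⟨s, hs⟩ : ∃ s : ℕ, (s:ℤ) = 3*p0^2 + 5*e :=
    ⟨(3*p0^2 + 5*e).toNat, Int.toNat_of_nonneg (by nlinarith [sq_nonneg h0, sq_nonneg p0])⟩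
  have e8 : e % 8 = 0 := by omega
  have hf8 : f % 8 = 1 := by
    obtain ⟨e', rfl⟩ : (8:ℤ) ∣ e := Int.dvd_of_emod_eq_zero e8
    obtain ⟨a', ha'⟩ : ∃ a', p0^2 = 8*a' + 1 := ⟨p0^2/8, by omega⟩
    have : (f:ℤ) = 8*(8*a'^2 + 2*a' + 4*(8*a'+1)*e' + 40*e'^2) + 1 := by rw [hf, ha']; ring
    omega
  have hs8 : s % 8 = 3 := by omega
  have hp3 : ∃ a', p0^2 = 3*a' + 1 := by
    have : ¬ (3:ℤ) ∣ p0 := by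
      rintro ⟨r, rfl⟩
      have h3 : (3:ℤ) ∣ h0 := Int.prime_three.dvd_of_dvd_pow (n := 2) ⟨3*r^2 + e, by rw [he]; ring⟩
      exact Int.prime_three.not_isUnit (hcop.isUnit_of_dvd' h3 (Dvd.intro _ rfl))
    have h1 : p0 % 3 = 1 ∨ p0 % 3 = 2 := by omega
    refine ⟨p0^2/3, ?_⟩
    have : p0^2 % 3 = 1 := by rcases h1 with h | h <;> simp [pow_two, Int.mul_emod, h]
    omega
  have hf3 : f % 3 = 2 := by
    obtain ⟨a', ha'⟩ := hp3
    obtain ⟨e', rfl⟩ : ∃ e', e = 3*e' + 2 := ⟨e/3, by omega⟩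
    have : (f:ℤ) = 3*(3*a'^2 + 2*a' + 4*a'*(3*e'+2) + 4*e' + 15*e'^2 + 20*e' + 9) + 2 := by
      rw [hf, ha']; ring
    omega
  have hp5 : p0^2 % 5 = 1 ∨ p0^2 % 5 = 4 := by
    have : p0 % 5 = 1 ∨ p0 % 5 = 2 ∨ p0 % 5 = 3 ∨ p0 % 5 = 4 := by omega
    rcases this with h | h | h | h <;> simp [pow_two, Int.mul_emod, h]
  have hs5 : s % 5 = 3 ∨ s % 5 = 2 := by omega
  have hfodd : Odd f := Nat.odd_iff.mpr (by omega)
  have hsodd : Odd s := Nat.odd_iff.mpr (by omega)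
  -- primes dividing f
  have hl : ∀ l : ℕ, l.Prime → l ∣ f → ¬ (l:ℤ) ∣ 6 * p0 := by
    intro l hlp hlf hdiv
    have hlp' : Prime (l:ℤ) := Nat.prime_iff_prime_int.mp hlp
    have hlf' : (l:ℤ) ∣ f := by exact_mod_cast hlf
    rcases hlp'.dvd_or_dvd hdiv with h | h
    · have h6 : l ∣ 2*3 := by exact_mod_cast h
      rcases (hlp.dvd_mul).mp h6 with h | h
      · rw [Nat.prime_dvd_prime_iff_eq hlp Nat.prime_two] at h
        subst h; omega
      · rw [Nat.prime_dvd_prime_iff_eq hlp Nat.prime_three] at h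
        subst h; omega
    · have h2 : (l:ℤ) ∣ 5*e^2 := by
        have : 5*e^2 = f - p0*(p0^3 + 4*p0*e) := by rw [hf]; ring
        rw [this]
        exact dvd_sub hlf' (h.mul_right _)
      rcases hlp'.dvd_or_dvd h2 with h3 | h3
      · have h3' : l ∣ 5 := by exact_mod_cast h3
        rw [Nat.prime_dvd_prime_iff_eq hlp Nat.prime_five] at h3'
        subst h3'; exact h5 (by exact_mod_cast h)
      · have h4 := hlp'.dvd_of_dvd_pow h3
        have h6 : (l:ℤ) ∣ h0 := by
          apply hlp'.dvd_of_dvd_pow (n := 2)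
          rw [he]
          exact dvd_add (dvd_pow h two_ne_zero) (h4.mul_left _)
        exact hlp'.not_isUnit (hcop.isUnit_of_dvd' h6 h)
  have hl18 : ∀ l : ℕ, l.Prime → l ∣ f → ¬ (l:ℤ) ∣ 18 * p0^4 := by
    intro l hlp hlf hdiv
    have hlp' : Prime (l:ℤ) := Nat.prime_iff_prime_int.mp hlp
    refine hl l hlp hlf (hlp'.dvd_of_dvd_pow (n := 4) (hdiv.trans ⟨72, by ring⟩))
  have hSl : ∀ l : ℕ, l.Prime → l ∣ f → ¬ (l:ℤ) ∣ 3 * s := by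
    intro l hlp hlf hdiv
    have hlf' : (l:ℤ) ∣ f := by exact_mod_cast hlf
    refine hl18 l hlp hlf ?_
    have : 18*p0^4 = f*45 - (3*s)*(5*h0^2-2*p0^2) := by rw [hf, hs, he]; ring
    rw [this]
    exact dvd_sub (hlf'.mul_right _) (hdiv.mul_right _)
  have hgcd : ∀ b : ℕ, b ∣ f → Int.gcd (3*s) b = 1 := by
    intro b hb
    by_contra hne
    obtain ⟨l, hlp, hld⟩ := Nat.exists_prime_and_dvd hne
    refine hSl l hlp (dvd_trans ?_ hb) ?_
    · have : (l:ℤ) ∣ b := (Int.natCast_dvd_natCast.mpr hld).trans (Int.gcd_dvd_right ..)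
      exact_mod_cast this
    · exact (Int.natCast_dvd_natCast.mpr hld).trans (Int.gcd_dvd_left ..)
  have hf0 : f ≠ 0 := by omega
  have J1 : jacobiSym (3*s) f = 1 := by
    obtain ⟨c, b, hbc, hsq⟩ := Nat.sq_mul_squarefree f
    have hc0 : c ≠ 0 := by rintro rfl; simp at hbc; omega
    have hb0 : b ≠ 0 := by rintro rfl; simp at hbc; omega
    have hcf : c ∣ f := ⟨b^2, by rw [← hbc]; ring⟩
    have hbf : b ∣ f := ⟨b*c, by rw [← hbc]; ring⟩
    rw [← hbc, jacobiSym.mul_right' _ (pow_ne_zero 2 hb0) hc0, jacobiSym.pow_right,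
      jacobiSym.sq_one (hgcd b hbf), one_mul]
    refine jac _ c hc0 ?_
    intro l hlp hlc
    have hlf := hlc.trans hcf
    have : Fact l.Prime := ⟨hlp⟩
    have hlp' : Prime (l:ℤ) := Nat.prime_iff_prime_int.mp hlp
    have hlf' : (l:ℤ) ∣ f := by exact_mod_cast hlf
    obtain ⟨c', rfl⟩ := hlc
    have hc' : ¬ (l:ℤ) ∣ (c':ℤ) := by
      intro h
      have h' : l ∣ c' := by exact_mod_cast h
      have := hsq l (mul_dvd_mul_left l h')
      exact hlp.one_lt.ne' (Nat.isUnit_iff.mp this)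
    have hsqT := desc l (6*(h0^2-p0^2)*(5*h0^4-2*p0^4)) c' hc' _ d x (b*y) rfl hd (by
      rw [hT, ← hf, ← hbc]; push_cast; ring)
    have hfz : ((f:ℤ) : ZMod l) = 0 := by
      rw [ZMod.intCast_zmod_eq_zero_iff_dvd]; exact hlf'
    have hSz : ((3*s : ℤ) : ZMod l) ≠ 0 := by
      rw [Ne, ZMod.intCast_zmod_eq_zero_iff_dvd]; exact hSl l hlp hlf
    have hWz : ((6*p0^2*(h0^2+2*p0^2) : ℤ) : ZMod l) ≠ 0 := by
      rw [Ne, ZMod.intCast_zmod_eq_zero_iff_dvd]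
      intro h
      refine hl18 l hlp hlf ?_
      rcases hlp'.dvd_or_dvd h with h | h
      · exact h.trans ⟨3*p0^2, by ring⟩
      · have : 18*p0^4 = f*9 - (h0^2+2*p0^2)*(5*h0^2-8*p0^2) := by rw [hf, he]; ring
        rw [this]
        exact dvd_sub (hlf'.mul_right _) (h.mul_right _)
    have hid : (((6*(h0^2-p0^2)*(5*h0^4-2*p0^4)) : ℤ) : ZMod l) * ((3*s : ℤ) : ZMod l)
        = ((6*p0^2*(h0^2+2*p0^2) : ℤ) : ZMod l)^2 := by
      have : (6*(h0^2-p0^2)*(5*h0^4-2*p0^4)) * (3*s)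
        = (6*p0^2*(h0^2+2*p0^2))^2 + f*(9*(30*h0^4 - 18*h0^2*p0^2 - 48*p0^4)) := by
        have h4 : h0^4 = (p0^2+3*e)^2 := by rw [← he]; ring
        rw [hf, hs, h4, he]; ring
      have := congrArg (Int.cast : ℤ → ZMod l) this
      rw [Int.cast_mul, Int.cast_add, Int.cast_mul (f:ℤ), hfz, zero_mul, add_zero, Int.cast_pow] at this
      exact this
    rw [← jacobiSym.legendreSym.to_jacobiSym, legendreSym.eq_one_iff _ hSz]
    obtain ⟨t, ht⟩ := hsqT
    rw [ht] at hid
    have ht0 : t ≠ 0 := by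
      rintro rfl
      apply hWz
      simpa using hid.symm
    refine ⟨((6*p0^2*(h0^2+2*p0^2) : ℤ) : ZMod l) / t, ?_⟩
    rw [div_mul_div_comm, eq_div_iff (mul_ne_zero ht0 ht0)]
    linear_combination hid
  have J3 : jacobiSym 3 f = -1 := by
    have := jacobiSym.quadratic_reciprocity_one_mod_four' (a := 3) (b := f) (by decide) (by omega)
    rw [Nat.cast_ofNat] at this
    rw [this, jacobiSym.mod_left]
    have : ((f:ℤ) % (3:ℕ)) = 2 := by omega
    rw [this]; norm_num
  have Jr : jacobiSym s f = jacobiSym f s :=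
    jacobiSym.quadratic_reciprocity_one_mod_four' hsodd (by omega)
  have J5 : jacobiSym 5 s = -1 := by
    have := jacobiSym.quadratic_reciprocity_one_mod_four (a := 5) (b := s) (by decide) hsodd
    rw [Nat.cast_ofNat] at this
    rw [this, jacobiSym.mod_left]
    have : ((s:ℤ) % (5:ℕ)) = 3 ∨ ((s:ℤ) % (5:ℕ)) = 2 := by omega
    rcases this with h | h <;> rw [h] <;> norm_num
  have J2 : jacobiSym 2 s = -1 := by
    rw [jacobiSym.at_two hsodd, ZMod.χ₈_nat_eq_if_mod_eight, hs8]
    have : s % 2 = 1 := by omega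
    simp [this]
  have hps : Int.gcd p0 s = 1 := by
    rw [← Int.isCoprime_iff_gcd_eq_one]
    by_contra hne
    rw [Int.isCoprime_iff_gcd_eq_one] at hne
    obtain ⟨l, hlp, hld⟩ := Nat.exists_prime_and_dvd hne
    have hlp' : Prime (l:ℤ) := Nat.prime_iff_prime_int.mp hlp
    have a1 : (l:ℤ) ∣ p0 := (Int.natCast_dvd_natCast.mpr hld).trans (Int.gcd_dvd_left ..)
    have a2 : (l:ℤ) ∣ s := (Int.natCast_dvd_natCast.mpr hld).trans (Int.gcd_dvd_right ..)
    have a3 : (l:ℤ) ∣ 5*h0^2 := by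
      have : 5*h0^2 = s*3 - p0*(4*p0) := by rw [hs, he]; ring
      rw [this]; exact dvd_sub (a2.mul_right _) (a1.mul_right _)
    rcases hlp'.dvd_or_dvd a3 with h3 | h3
    · have h3' : l ∣ 5 := by exact_mod_cast h3
      rw [Nat.prime_dvd_prime_iff_eq hlp Nat.prime_five] at h3'
      subst h3'; exact h5 (by exact_mod_cast a1)
    · exact hlp'.not_isUnit (hcop.isUnit_of_dvd' (hlp'.dvd_of_dvd_pow h3) a1)
  have Jc : jacobiSym (5*f) s = jacobiSym (2*(p0^2)^2) s := by
    apply jacobiSym.mod_left'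
    have : (5*f : ℤ) = 2*(p0^2)^2 + s*(p0^2+5*e) := by rw [hf, hs]; ring
    rw [this, Int.add_mul_emod_self_left]
  rw [jacobiSym.mul_left, jacobiSym.mul_left, jacobiSym.pow_left, jacobiSym.pow_left,
    jacobiSym.sq_one hps, J5, J2] at Jc
  rw [jacobiSym.mul_left, J3, Jr] at J1
  norm_num at Jc
  rw [Jc] at J1
  norm_num at J1

lemma core (u v p q g h : ℤ)
    (e1 : p^2 + 2*q^2 = 3*(u^2 - 2*u*v - v^2))
    (e2 : h^2 + 2*g*h + 2*p*q = 0)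
    (e3 : 2*g^2 + 2*h^2 - 2*p*q = 3*(u^2 + 4*u*v - v^2))
    (hn2 : ¬ (2 ∣ u ∧ 2 ∣ v ∧ 2 ∣ p ∧ 2 ∣ q ∧ 2 ∣ g ∧ 2 ∣ h))
    (hn3 : ¬ (3 ∣ u ∧ 3 ∣ v ∧ 3 ∣ p ∧ 3 ∣ q ∧ 3 ∣ g ∧ 3 ∣ h))
    (hn5 : ¬ (5 ∣ u ∧ 5 ∣ v ∧ 5 ∣ p ∧ 5 ∣ q ∧ 5 ∣ g ∧ 5 ∣ h)) : False := by
  have h9 := three_adic u v p q g h e1 e2 e3 hn3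
  obtain ⟨k, P, rfl, rfl, hk, hP⟩ := two_adic u v p q g h e1 e2 e3 hn2
  have hk0 : k ≠ 0 := by rintro rfl; simp at hk
  obtain ⟨h0, p0, hcop, hk', hP'⟩ : ∃ h0 p0 : ℤ, IsCoprime h0 p0 ∧ k = (Int.gcd k P : ℤ) * h0 ∧ P = (Int.gcd k P : ℤ) * p0 := by
    have hpos : 0 < Int.gcd k P := Int.gcd_pos_of_ne_zero_left _ hk0
    refine ⟨k / Int.gcd k P, P / Int.gcd k P, ?_, ?_, ?_⟩
    · rw [Int.isCoprime_iff_gcd_eq_one]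
      exact Int.gcd_ediv_gcd_ediv_gcd hpos
    · exact (Int.mul_ediv_cancel' (Int.gcd_dvd_left ..)).symm
    · exact (Int.mul_ediv_cancel' (Int.gcd_dvd_right ..)).symm
  generalize (Int.gcd k P : ℤ) = d at hk' hP'
  subst hk' hP'
  have hd : d ≠ 0 := left_ne_zero_of_mul hk0
  obtain ⟨hdo, hh⟩ := Int.odd_mul.mp hk
  obtain ⟨-, hp⟩ := Int.odd_mul.mp hP
  have h5 : ¬ (5:ℤ) ∣ p0 := by
    refine five_adic u v q g h0 p0 (2*d) ?_ ?_ ?_ (by simpa using hd) hcop ?_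
    · linear_combination e1
    · linear_combination e2
    · linear_combination e3
    · rw [mul_assoc, mul_assoc]; exact hn5
  obtain ⟨w, hw⟩ := h9
  have hd3 : ¬ (3:ℤ) ∣ d := by
    rintro ⟨r, rfl⟩
    have : 36*(r*h0)^2 - 36*(r*p0)^2 - 6 = 9*w := by linear_combination hw
    omega
  have hd1 : d^2 % 3 = 1 := by
    have h1 : d % 3 = 1 ∨ d % 3 = 2 := by omega
    rcases h1 with h | h <;> simp [pow_two, Int.mul_emod, h]
  obtain ⟨D, hD⟩ : ∃ D, d^2 = 3*D + 1 := ⟨d^2/3, by omega⟩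
  have hw' : 4*(3*D+1)*(h0^2-p0^2) = 9*w + 6 := by rw [← hD]; linear_combination hw
  obtain ⟨e, he⟩ : (3:ℤ) ∣ h0^2-p0^2 :=
    ⟨3*w + 2 - 4*D*(h0^2-p0^2) - (h0^2-p0^2), by linear_combination hw'⟩
  rw [he] at hw'
  have he3 : e % 3 = 2 := by
    have : 4*(D*e)*3 + 4*e = 3*w + 2 := by linarith
    omega
  refine final h0 p0 e (2*d) (6*((h0^2-p0^2)*u + (2*h0^2+p0^2)*v)) (18*v) (by simpa using hd) (by linarith) he3 hh hp h5 hcop ?_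
  have f2 : h0*g = -(p0*q + d*h0^2) := by
    apply mul_left_cancel₀ (mul_ne_zero four_ne_zero hd); linear_combination e2
  have f3 : 2*p0^2*q^2 + 10*d^2*h0^4 = 3*h0^2*(u^2 + 4*u*v - v^2) := by
    linear_combination h0^2*e3 - 2*(h0*g - (p0*q + d*h0^2))*f2
  have f4 : 2*d^2*(5*h0^4-2*p0^4) = 3*(h0^2*(u^2 + 4*u*v - v^2) - p0^2*(u^2 - 2*u*v - v^2)) := by
    linear_combination f3 - p0^2*e1
  have f5 : 5*h0^4 + 2*h0^2*p0^2 + 2*p0^4 = 9*((p0^2)^2 + 4*p0^2*e + 5*e^2) := by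
    obtain he' : h0^2 = p0^2 + 3*e := by linarith
    have h4 : h0^4 = (p0^2+3*e)^2 := by rw [← he']; ring
    rw [h4, he']; ring
  linear_combination 12*(h0^2-p0^2)*f4 - 36*v^2*f5

lemma descent : ∀ (n : ℕ) (u v p q g h : ℤ),
    u.natAbs + v.natAbs + p.natAbs + q.natAbs + g.natAbs + h.natAbs = n →
    p^2 + 2*q^2 = 3*(u^2 - 2*u*v - v^2) → h^2 + 2*g*h + 2*p*q = 0 →
    2*g^2 + 2*h^2 - 2*p*q = 3*(u^2 + 4*u*v - v^2) →
    u = 0 ∧ v = 0 ∧ p = 0 ∧ q = 0 ∧ g = 0 ∧ h = 0 := by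
  intro n
  induction n using Nat.strong_induction_on with
  | _ n ih =>
    intro u v p q g h hsum e1 e2 e3
    by_contra hne
    have key : ∀ r : ℤ, 2 ≤ r → ¬ (r ∣ u ∧ r ∣ v ∧ r ∣ p ∧ r ∣ q ∧ r ∣ g ∧ r ∣ h) := by
      rintro r hr ⟨⟨u, rfl⟩, ⟨v, rfl⟩, ⟨p, rfl⟩, ⟨q, rfl⟩, ⟨g, rfl⟩, ⟨h, rfl⟩⟩
      have hr2 : r^2 ≠ 0 := by positivity
      have hne' : ¬ (u = 0 ∧ v = 0 ∧ p = 0 ∧ q = 0 ∧ g = 0 ∧ h = 0) := by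
        rintro ⟨rfl, rfl, rfl, rfl, rfl, rfl⟩
        simp at hne
      refine hne' (ih _ ?_ u v p q g h rfl ?_ ?_ ?_)
      · simp only [Int.natAbs_mul] at hsum
        have hr' : 2 ≤ r.natAbs := by omega
        have hpos : 0 < u.natAbs + v.natAbs + p.natAbs + q.natAbs + g.natAbs + h.natAbs := by omega
        rw [← hsum]
        nlinarith
      · apply mul_left_cancel₀ hr2; linear_combination e1
      · apply mul_left_cancel₀ hr2; linear_combination e2
      · apply mul_left_cancel₀ hr2; linear_combination e3
    exact core u v p q g h e1 e2 e3 (key 2 (by norm_num)) (key 3 (by norm_num)) (key 5 (by norm_num))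

lemma clear_den (a : ℚ) : ∃ n : ℕ, n ≠ 0 ∧ ∃ z : ℤ, a * n = z :=
  ⟨a.den, a.den_nz, a.num, Rat.mul_den_eq_num a⟩

lemma rational (u v p q g h : ℚ)
    (e1 : p^2 + 2*q^2 = 3*(u^2 - 2*u*v - v^2))
    (e2 : h^2 + 2*g*h + 2*p*q = 0)
    (e3 : 2*g^2 + 2*h^2 - 2*p*q = 3*(u^2 + 4*u*v - v^2)) :
    u = 0 ∧ v = 0 ∧ p = 0 ∧ q = 0 ∧ g = 0 ∧ h = 0 := by
  obtain ⟨N, hN, u', v', p', q', g', h', hu, hv, hp, hq, hg, hh⟩ :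
      ∃ N : ℚ, N ≠ 0 ∧ ∃ u' v' p' q' g' h' : ℤ, u*N = u' ∧ v*N = v' ∧ p*N = p' ∧ q*N = q' ∧
        g*N = g' ∧ h*N = h' := by
    obtain ⟨a1, ha1, z1, h1⟩ := clear_den u
    obtain ⟨a2, ha2, z2, h2⟩ := clear_den v
    obtain ⟨a3, ha3, z3, h3⟩ := clear_den p
    obtain ⟨a4, ha4, z4, h4⟩ := clear_den q
    obtain ⟨a5, ha5, z5, h5⟩ := clear_den g
    obtain ⟨a6, ha6, z6, h6⟩ := clear_den h
    refine ⟨a1*a2*a3*a4*a5*a6, by positivity, z1*a2*a3*a4*a5*a6, z2*a1*a3*a4*a5*a6,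
      z3*a1*a2*a4*a5*a6, z4*a1*a2*a3*a5*a6, z5*a1*a2*a3*a4*a6, z6*a1*a2*a3*a4*a5, ?_, ?_, ?_, ?_, ?_, ?_⟩
    · push_cast; rw [← h1]; ring
    · push_cast; rw [← h2]; ring
    · push_cast; rw [← h3]; ring
    · push_cast; rw [← h4]; ring
    · push_cast; rw [← h5]; ring
    · push_cast; rw [← h6]; ring
  have E1 : p'^2 + 2*q'^2 = 3*(u'^2 - 2*u'*v' - v'^2) := by
    have : (p':ℚ)^2 + 2*q'^2 = 3*(u'^2 - 2*u'*v' - v'^2) := by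
      rw [← hu, ← hv, ← hp, ← hq]; linear_combination N^2*e1
    exact_mod_cast this
  have E2 : h'^2 + 2*g'*h' + 2*p'*q' = 0 := by
    have : (h':ℚ)^2 + 2*g'*h' + 2*p'*q' = 0 := by
      rw [← hg, ← hh, ← hp, ← hq]; linear_combination N^2*e2
    exact_mod_cast this
  have E3 : 2*g'^2 + 2*h'^2 - 2*p'*q' = 3*(u'^2 + 4*u'*v' - v'^2) := by
    have : 2*(g':ℚ)^2 + 2*h'^2 - 2*p'*q' = 3*(u'^2 + 4*u'*v' - v'^2) := by
      rw [← hu, ← hv, ← hg, ← hh, ← hp, ← hq]; linear_combination N^2*e3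
    exact_mod_cast this
  obtain ⟨rfl, rfl, rfl, rfl, rfl, rfl⟩ := descent _ u' v' p' q' g' h' rfl E1 E2 E3
  simp only [Int.cast_zero, mul_eq_zero, hN, or_false] at hu hv hp hq hg hh
  exact ⟨hu, hv, hp, hq, hg, hh⟩


/-- The only rational solution of `q₁ = q₂ = q₃ = 0` is the zero tuple;
equivalently the projective K3 surface `V ⊂ ℙ⁵_ℚ` defined by these three quadrics (attached to
`f = (x²+1)(x²−2x−1)(x²+x−1)` and `δ = (−2X⁵+3X⁴+5X³−8X²+7X+7)/6`) has no ℚ-rational points. -/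
theorem statement17 (x1 x2 x3 x4 x5 x6 : ℚ)
    (h1 : x1^2 + 2*x1*x3 + 8*x1*x4 + 10*x1*x5 + 24*x1*x6 + x2^2 + 8*x2*x3 + 10*x2*x4
        + 24*x2*x5 + 58*x2*x6 + 5*x3^2 + 24*x3*x4 + 58*x3*x5 + 152*x3*x6 + 29*x4^2
        + 152*x4*x5 + 346*x4*x6 + 173*x5^2 + 856*x5*x6 + 1017*x6^2 = 0)
    (h2 : x1*x2 + 2*x1*x3 + 3*x1*x4 + 6*x1*x5 + 17*x1*x6 + x2^2 + 3*x2*x3 + 6*x2*x4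
        + 17*x2*x5 + 40*x2*x6 + 3*x3^2 + 17*x3*x4 + 40*x3*x5 + 97*x3*x6 + 20*x4^2
        + 97*x4*x5 + 230*x4*x6 + 115*x5^2 + 563*x5*x6 + 675*x6^2 = 0)
    (h3 : 6*x1*x3 + 8*x1*x4 + 12*x1*x5 + 30*x1*x6 + 3*x2^2 + 8*x2*x3 + 12*x2*x4
        + 30*x2*x5 + 84*x2*x6 + 6*x3^2 + 30*x3*x4 + 84*x3*x5 + 192*x3*x6 + 42*x4^2
        + 192*x4*x5 + 466*x4*x6 + 233*x5^2 + 1112*x5*x6 + 1360*x6^2 = 0) :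
    x1 = 0 ∧ x2 = 0 ∧ x3 = 0 ∧ x4 = 0 ∧ x5 = 0 ∧ x6 = 0 := by
  obtain ⟨a1, a2, a3, a4, a5, a6⟩ := rational
    ((1)*x1 + (-1)*x3 + (1)*x5)
    ((1)*x2 + (-1)*x4 + (1)*x6)
    ((1)*x1 + (1)*x2 + (3)*x3 + (7)*x4 + (17)*x5 + (41)*x6)
    ((1)*x2 + (2)*x3 + (5)*x4 + (12)*x5 + (29)*x6)
    ((1)*x2 + (-1)*x3 + (2)*x4 + (-3)*x5 + (5)*x6)
    ((1)*x1 + (1)*x3 + (-1)*x4 + (2)*x5 + (-3)*x6)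
    (by linear_combination -2*h1 + 8*h2) (by linear_combination h1 + 4*h2 - h3)
    (by linear_combination -h1 - 14*h2 + 6*h3)
  refine ⟨?_, ?_, ?_, ?_, ?_, ?_⟩
  · linear_combination (3/20)*a1 + (1/20)*a2 + (7/12)*a3 + (-5/6)*a4 + (1/5)*a5 + (4/15)*a6
  · linear_combination (1/10)*a1 + (1/5)*a2 + (-5/6)*a3 + (7/6)*a4 + (7/15)*a5 + (11/15)*a6
  · linear_combination (-13/20)*a1 + (-1/20)*a2 + (1/4)*a3 + (-1/3)*a4 + (2/15)*a5 + (2/5)*a6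
  · linear_combination (1/20)*a1 + (-13/20)*a2 + (-7/12)*a3 + (5/6)*a4 + (2/5)*a5 + (8/15)*a6
  · linear_combination (1/5)*a1 + (-1/10)*a2 + (-1/3)*a3 + (1/2)*a4 + (-1/15)*a5 + (2/15)*a6
  · linear_combination (-1/20)*a1 + (3/20)*a2 + (1/4)*a3 + (-1/3)*a4 + (-1/15)*a5 + (-1/5)*a6
end

section
/- For every prime number p there exists (x₁,…,x₆) ∈ ℚ_p⁶ with (x₁,…,x₆) ≠ 0 satisfying q₁ = q₂ = q₃ = 0, and there exists (x₁,…,x₆) ∈ ℝ⁶ with (x₁,…,x₆) ≠ 0 satisfying q₁ = q₂ = q₃ = 0; that is, the projective surface V ⊂ ℙ⁵ defined by q₁ = q₂ = q₃ = 0 has points over every completion of ℚ. -/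
/-- Solubility of the system over a field `K`. -/
def Sol18 (K : Type*) [Field K] : Prop :=
    ∃ x1 x2 x3 x4 x5 x6 : K,
      (x1, x2, x3, x4, x5, x6) ≠ (0, 0, 0, 0, 0, 0) ∧
      x1^2 + 2*x1*x3 + 8*x1*x4 + 10*x1*x5 + 24*x1*x6 + x2^2 + 8*x2*x3 + 10*x2*x4
        + 24*x2*x5 + 58*x2*x6 + 5*x3^2 + 24*x3*x4 + 58*x3*x5 + 152*x3*x6 + 29*x4^2
        + 152*x4*x5 + 346*x4*x6 + 173*x5^2 + 856*x5*x6 + 1017*x6^2 = 0 ∧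
      x1*x2 + 2*x1*x3 + 3*x1*x4 + 6*x1*x5 + 17*x1*x6 + x2^2 + 3*x2*x3 + 6*x2*x4
        + 17*x2*x5 + 40*x2*x6 + 3*x3^2 + 17*x3*x4 + 40*x3*x5 + 97*x3*x6 + 20*x4^2
        + 97*x4*x5 + 230*x4*x6 + 115*x5^2 + 563*x5*x6 + 675*x6^2 = 0 ∧
      6*x1*x3 + 8*x1*x4 + 12*x1*x5 + 30*x1*x6 + 3*x2^2 + 8*x2*x3 + 12*x2*x4
        + 30*x2*x5 + 84*x2*x6 + 6*x3^2 + 30*x3*x4 + 84*x3*x5 + 192*x3*x6 + 42*x4^2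
        + 192*x4*x5 + 466*x4*x6 + 233*x5^2 + 1112*x5*x6 + 1360*x6^2 = 0

/-- Key lemma: a quadratic polynomial `a X² + b X + c` which is `δ` times a square
modulo each of the three factors of `f` gives a point. -/
lemma sol18_of {K : Type*} [Field K] [CharZero K] (a b c s1 t1 s2 t2 s3 t3 : K)
    (h1 : 3 * (s1^2 - t1^2) = c - a) (h2 : 6 * (s1 * t1) = b)
    (h3 : -(s2^2 + 2*t2^2) - 4*(s2*t2) = 3*a + b + c)
    (h4 : -(s2^2 + 2*t2^2) - 2*(s2*t2) = 2*a + b)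
    (h5 : (s3^2 + 5*t3^2 + 10*(s3*t3)) / 2 = (3*a - b)/2 + c)
    (h6 : (s3^2 + 5*t3^2 + 2*(s3*t3)) / 2 = (b - a)/2)
    (hne : t3 ≠ 0) : Sol18 K := by
  refine ⟨(3/20)*s1 + (1/20)*t1 + (7/12)*s2 + (-5/6)*t2 + (4/15)*s3 + (2/3)*t3,
    (1/10)*s1 + (1/5)*t1 + (-5/6)*s2 + (7/6)*t2 + (11/15)*s3 + (5/3)*t3,
    (-13/20)*s1 + (-1/20)*t1 + (1/4)*s2 + (-1/3)*t2 + (2/5)*s3 + (2/3)*t3,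
    (1/20)*s1 + (-13/20)*t1 + (-7/12)*s2 + (5/6)*t2 + (8/15)*s3 + (4/3)*t3,
    (1/5)*s1 + (-1/10)*t1 + (-1/3)*s2 + (1/2)*t2 + (2/15)*s3,
    (-1/20)*s1 + (3/20)*t1 + (1/4)*s2 + (-1/3)*t2 + (-1/5)*s3 + (-1/3)*t3, ?_, ?_, ?_, ?_⟩
  · intro h
    simp only [Prod.mk.injEq] at h
    obtain ⟨_, e2, e3, e4, e5, e6⟩ := h
    apply hne
    linear_combination (1/2)*e2 + (-1/2)*e3 + e4 + (-3/2)*e5 + (5/2)*e6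
  · linear_combination (1/30)*h1 + (-13/30)*h2 + (-5/6)*h3 + h4 + (4/5)*h5 + (4/3)*h6
  · linear_combination (-7/60)*h1 + (1/60)*h2 + (-1/12)*h3 + (1/5)*h5 + (1/3)*h6
  · linear_combination (-13/30)*h1 + (-11/30)*h2 + (-1/6)*h3 + (3/5)*h5 + (5/3)*h6

section cases
variable {K : Type*} [Field K]

lemma sq_ne_zero18 {x y : K} (h : x ^ 2 = y) (hy : y ≠ 0) : x ≠ 0 := by
  rintro rfl
  exact hy (by rw [← h]; ring)

variable [CharZero K]

lemma sol18_N (w : K) (hw : w^2 = -2) : Sol18 K := by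
  have hw0 : w ≠ 0 := sq_ne_zero18 hw (by norm_num)
  have hi : (1/w)^2 = -1/2 := by rw [div_pow, hw]; norm_num
  refine sol18_of 1 (-3) 1 (1/w) (1/w) 1 (-1) (3*w/2) (-w/2) ?_ ?_ ?_ ?_ ?_ ?_ ?_
  · ring
  · linear_combination 6*hi
  · ring
  · ring
  · linear_combination (-2)*hw
  · linear_combination hw
  · simpa using hw0

lemma sol18_C (r e : K) (hr : r^2 = 2) (h : e^2 = 1 + r ∨ e^2 = -(1+r)) : Sol18 K := by
  have hr1 : 1 + r ≠ 0 := by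
    intro h
    have : (1 + r) * (1 - r) = -1 := by linear_combination -hr
    rw [h] at this
    norm_num at this
  rcases h with h | h
  · have he : e ≠ 0 := sq_ne_zero18 h hr1
    have hi : (1/e)^2 * (1+r) = 1 := by rw [← h]; field_simp
    refine sol18_of (-3) 6 3 ((1+r)*(1/e)) (1/e) 0 0 (-3/2) (3/2) ?_ ?_ ?_ ?_ ?_ ?_ ?_
    · linear_combination 6*hi + 3*(1/e)^2*hr
    · linear_combination 6*hi
    all_goals norm_num
  · have he : e ≠ 0 := sq_ne_zero18 h (neg_ne_zero.mpr hr1)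
    have hi : (1/e)^2 * (1+r) = -1 := by
      have : (1/e)^2 * e^2 = 1 := by field_simp
      linear_combination -this + (1/e)^2 * h
    refine sol18_of (-3) 6 3 (-(1/e)) ((1+r)*(1/e)) 0 0 (-3/2) (3/2) ?_ ?_ ?_ ?_ ?_ ?_ ?_
    · linear_combination (-6)*hi - 3*(1/e)^2*hr
    · linear_combination (-6)*hi
    all_goals norm_num

lemma sol18_B (j f : K) (hj : j^2 = -1) (hf : f^2 = 6) : Sol18 K := by
  have hf0 : f ≠ 0 := sq_ne_zero18 hf (by norm_num)
  have hi : (1/f)^2 = 1/6 := by rw [div_pow, hf]; norm_num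
  refine sol18_of 0 1 0 (1/f) (1/f) j 0 (-1/2) (1/2) ?_ ?_ ?_ ?_ ?_ ?_ ?_
  · ring
  · linear_combination 6*hi
  · linear_combination -hj
  · linear_combination -hj
  all_goals norm_num

lemma sol18_D (j v e : K) (hj : j^2 = -1) (hv : v^2 = 5) (he : e^2 = 1 + v) : Sol18 K := by
  have hv1 : 1 + v ≠ 0 := by
    intro h
    have : (1 + v) * (1 - v) = -4 := by linear_combination -hv
    rw [h] at this
    norm_num at this
  have he0 : e ≠ 0 := sq_ne_zero18 he hv1
  have hi : (1/e)^2 * (1+v) = 1 := by rw [← he]; field_simp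
  have hj0 : j ≠ 0 := sq_ne_zero18 hj (by norm_num)
  refine sol18_of 1 (-12) 7 ((1+v)*(1/e)) (-2*(1/e)) 4 (-1) (7*j/2) (-3*j/2) ?_ ?_ ?_ ?_ ?_ ?_ ?_
  · linear_combination 6*hi + 3*(1/e)^2*hv
  · linear_combination (-12)*hi
  · norm_num
  · norm_num
  · linear_combination (-29/2)*hj
  · linear_combination (13/2)*hj
  · simpa using hj0

lemma sol18_A (j s e g : K) (hj : j^2 = -1) (hs : s^2 = 3)
    (he : e^2 = 1 + j ∨ e^2 = 2 * (1+j)) (hg : g^2 = 1 + 2*j ∨ g^2 = 5*(1+2*j)) : Sol18 K := by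
  have hj1 : 1 + j ≠ 0 := by
    intro h
    have : (1 + j) * (1 - j) = 2 := by linear_combination -hj
    rw [h] at this
    norm_num at this
  have hj2 : 1 + 2*j ≠ 0 := by
    intro h
    have : (1 + 2*j) * (1 - 2*j) = 5 := by linear_combination -4*hj
    rw [h] at this
    norm_num at this
  have hj0 : j ≠ 0 := sq_ne_zero18 hj (by norm_num)
  have hs0 : s ≠ 0 := sq_ne_zero18 hs (by norm_num)
  have key2 : ∃ s2 t2 : K, s2^2 + 2*t2^2 = 3 ∧ 2*(s2*t2) = -3 := by
    rcases he with h | h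
    · have he0 : e ≠ 0 := sq_ne_zero18 h hj1
      have hi : (1/e)^2 * (1+j) = 1 := by rw [← h]; field_simp
      refine ⟨-s*(1/e), s*(1+j)/2*(1/e), ?_, ?_⟩
      · linear_combination 3*hi + (1/e)^2*((1+j)^2/2+1)*hs + (1/e)^2*(3/2)*hj
      · linear_combination (-3)*hi - (1/e)^2*(1+j)*hs
    · have he0 : e ≠ 0 := sq_ne_zero18 h (mul_ne_zero two_ne_zero hj1)
      have hi : (1/e)^2 * (1+j) = 1/2 := by
        have : (1/e)^2 * e^2 = 1 := by field_simp
        linear_combination (1/2)*this - (1/2)*(1/e)^2 * h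
      refine ⟨s*(1+j)*(1/e), -s*(1/e), ?_, ?_⟩
      · linear_combination 6*hi + (1/e)^2*((1+j)^2+2)*hs + (1/e)^2*3*hj
      · linear_combination (-6)*hi - 2*(1/e)^2*(1+j)*hs
  have key3 : ∃ s3 t3 : K, s3^2 + 5*t3^2 = -3/2 ∧ 2*(s3*t3) = 3/2 ∧ t3 ≠ 0 := by
    have aux : ∃ s3 t3 : K, s3^2 + 5*t3^2 = -3/2 ∧ 2*(s3*t3) = 3/2 := by
      rcases hg with h | h
      · have hg0 : g ≠ 0 := sq_ne_zero18 h hj2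
        have hi : (1/g)^2 * (1+2*j) = 1 := by rw [← h]; field_simp
        refine ⟨s*(2-j)/2*(1/g), s*j/2*(1/g), ?_, ?_⟩
        · linear_combination (1/g)^2*((2-j)^2+5*j^2)/4*hs - 3/2*hi + (9/2)*(1/g)^2*hj
        · linear_combination (1/g)^2*(2-j)*j/2*hs + 3/2*hi - 3/2*(1/g)^2*hj
      · have hg0 : g ≠ 0 := sq_ne_zero18 h (mul_ne_zero (by norm_num) hj2)
        have hi : (1/g)^2 * (1+2*j) = 1/5 := by
          have : (1/g)^2 * g^2 = 1 := by field_simp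
          linear_combination (1/5)*this - (1/5)*(1/g)^2 * h
        refine ⟨5*s*j/2*(1/g), s*(2-j)/2*(1/g), ?_, ?_⟩
        · linear_combination 5*(1/g)^2*((2-j)^2+5*j^2)/4*hs - 15/2*hi + (45/2)*(1/g)^2*hj
        · linear_combination 5*(1/g)^2*(2-j)*j/2*hs + 15/2*hi - 15/2*(1/g)^2*hj
    obtain ⟨s3, t3, b1, b2⟩ := aux
    refine ⟨s3, t3, b1, b2, ?_⟩
    rintro rfl
    norm_num at b2
  obtain ⟨s2, t2, a1, a2⟩ := key2
  obtain ⟨s3, t3, b1, b2, b3⟩ := key3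
  refine sol18_of 0 0 3 1 0 s2 t2 s3 t3 ?_ ?_ ?_ ?_ ?_ ?_ b3
  · norm_num
  · norm_num
  · linear_combination -a1 - 2*a2
  · linear_combination -a1 - a2
  · linear_combination (1/2)*b1 + (5/2)*b2
  · linear_combination (1/2)*b1 + (1/2)*b2

end cases

section padic
set_option linter.unusedSimpArgs false
open Polynomial

lemma sqm2_18 : IsSquare (-2 : ZMod 3) := ⟨1, by decide⟩

lemma sqm1_18 : IsSquare (-1 : ZMod 5) := ⟨2, by decide⟩

lemma sq6_18 : IsSquare (6 : ZMod 5) := ⟨1, by decide⟩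

/-- Hensel's lemma for square roots, odd residue characteristic. -/
lemma sq_lift18 (p : ℕ) [Fact p.Prime] (hp : p ≠ 2) (u : ℤ_[p]) (hu : IsUnit u)
    (h : IsSquare (PadicInt.toZMod u)) : ∃ z : ℤ_[p], z^2 = u := by
  obtain ⟨y, hy⟩ := h
  obtain ⟨a, rfl⟩ := (ZMod.ringHom_surjective (PadicInt.toZMod (p := p))) y
  have hker : ‖a^2 - u‖ < 1 := by
    rw [← PadicInt.mem_nonunits]
    rw [← IsLocalRing.mem_maximalIdeal, ← PadicInt.ker_toZMod, RingHom.mem_ker]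
    rw [map_sub, map_pow, hy]; ring
  have hua : IsUnit a := by
    by_contra hna
    have h1 : ‖a‖ < 1 := by rwa [← PadicInt.mem_nonunits]
    have h0 : PadicInt.toZMod a = 0 := by
      rw [← RingHom.mem_ker, PadicInt.ker_toZMod, IsLocalRing.mem_maximalIdeal]
      exact hna
    have := hu.map (PadicInt.toZMod (p := p))
    rw [hy, h0] at this
    simp at this
  have h2 : ‖(2 : ℤ_[p])‖ = 1 := by
    have := PadicInt.norm_int_lt_one_iff_dvd (p := p) 2
    by_contra hne
    have hlt : ‖(2 : ℤ_[p])‖ < 1 := lt_of_le_of_ne (PadicInt.norm_le_one _) hne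
    have h3 : (p : ℤ) ∣ 2 := this.mp (by exact_mod_cast hlt)
    have h4 : p ∣ 2 := by exact_mod_cast h3
    exact hp ((Nat.prime_dvd_prime_iff_eq (Fact.out) Nat.prime_two).mp h4)
  have := hensels_lemma (p := p) (R := ℤ_[p]) (F := (X^2 - C u : ℤ_[p][X])) (a := a) (by
    simp only [map_sub, map_pow, aeval_X, aeval_C, derivative_X_pow,
      derivative_C]
    simp [h2, PadicInt.isUnit_iff.mp hua]
    simpa using hker)
  obtain ⟨z, hz, _⟩ := this
  refine ⟨z, ?_⟩
  simp at hz
  linear_combination hz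

lemma sq_dich18 (p : ℕ) [Fact p.Prime] (hp : p ≠ 2) (u v : ℤ_[p]) (hu : IsUnit u)
    (hv : IsUnit v) : (∃ z, z^2 = u) ∨ (∃ z, z^2 = v) ∨ ∃ z, z^2 = u * v := by
  by_cases h1 : IsSquare (PadicInt.toZMod u)
  · exact Or.inl (sq_lift18 p hp u hu h1)
  by_cases h2 : IsSquare (PadicInt.toZMod v)
  · exact Or.inr (Or.inl (sq_lift18 p hp v hv h2))
  refine Or.inr (Or.inr (sq_lift18 p hp _ (hu.mul hv) ?_))
  have hc : ringChar (ZMod p) ≠ 2 := by rwa [ZMod.ringChar_zmod_n]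
  have e1 := quadraticChar_neg_one_iff_not_isSquare.mpr h1
  have e2 := quadraticChar_neg_one_iff_not_isSquare.mpr h2
  have hne : PadicInt.toZMod (u * v) ≠ 0 := ((hu.mul hv).map PadicInt.toZMod).ne_zero
  rw [← quadraticChar_one_iff_isSquare hne, map_mul, map_mul, e1, e2]
  norm_num

lemma sq_two18 (w : ℤ_[2]) : ∃ y : ℤ_[2], y + 2*y^2 = w := by
  have h2 : ‖(2 : ℤ_[2])‖ < 1 := by
    have := PadicInt.norm_p (p := 2)
    norm_num at this
    rw [this]
    norm_num
  have hn : ‖(1 + 4*w : ℤ_[2])‖ = 1 := by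
    rw [← PadicInt.isUnit_iff]
    by_contra hna
    have h1 : ‖(1 + 4*w : ℤ_[2])‖ < 1 := by rwa [← PadicInt.mem_nonunits]
    have h3 : (1 : ℤ_[2]) ∈ IsLocalRing.maximalIdeal ℤ_[2] := by
      have e : (1 : ℤ_[2]) = (1 + 4*w) - 2 * (2*w) := by ring
      rw [e]
      refine Ideal.sub_mem _ ((IsLocalRing.mem_maximalIdeal _).mpr hna) (Ideal.mul_mem_right _ _ ?_)
      rw [IsLocalRing.mem_maximalIdeal, PadicInt.mem_nonunits]
      exact h2
    exact (IsLocalRing.mem_maximalIdeal _).mp h3 isUnit_one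
  have hw : ‖(2 * w^2 : ℤ_[2])‖ < 1 := by
    rw [norm_mul]
    calc ‖(2 : ℤ_[2])‖ * ‖w^2‖ ≤ ‖(2 : ℤ_[2])‖ * 1 := by
          gcongr; exact PadicInt.norm_le_one _
      _ < 1 := by rwa [mul_one]
  have := hensels_lemma (p := 2) (R := ℤ_[2]) (F := (X + C 2 * X^2 - C w : ℤ_[2][X])) (a := w) (by
    have e1 : (aeval w) (X + C 2 * X^2 - C w : ℤ_[2][X]) = 2*w^2 := by simp
    have e2 : (aeval w) (derivative (X + C 2 * X^2 - C w : ℤ_[2][X])) = 1 + 4*w := by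
      simp; ring
    rw [e1, e2, hn]
    simpa using hw)
  obtain ⟨z, hz, _⟩ := this
  refine ⟨z, ?_⟩
  simp at hz
  linear_combination hz

lemma sol18_two : Sol18 ℚ_[2] := by
  obtain ⟨y, hy⟩ := sq_two18 2
  obtain ⟨w, hw⟩ := sq_two18 (-5 + 3*y^2)
  have hy' : (y : ℚ_[2]) + 2 * (y : ℚ_[2])^2 = 2 := by exact_mod_cast congrArg Subtype.val hy
  have hw' : (w : ℚ_[2]) + 2 * (w : ℚ_[2])^2 = -5 + 3*(y : ℚ_[2])^2 := by
    exact_mod_cast congrArg Subtype.val hw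
  generalize (y : ℚ_[2]) = y at *
  generalize (w : ℚ_[2]) = w at *
  have he : (1 + 4*w)^2 = -3*(5+4*y) := by linear_combination 8*hw' + 12*hy'
  have h5 : (5 + 4*y) * (3 - 4*y) = -1 := by linear_combination -8*hy'
  have he0 : 1 + 4*w ≠ 0 := by
    refine sq_ne_zero18 he ?_
    intro h
    have : (5 + 4*y) = 0 := by linear_combination (-1/3)*h
    rw [this] at h5
    norm_num at h5
  have hi : (1/(1+4*w))^2 * (-3*(5+4*y)) = 1 := by rw [← he]; field_simp
  have hu : 3 * (1/(1+4*w))^2 = 3 - 4*y := by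
    linear_combination (3 - 4*y)*hi + 3*(1/(1+4*w))^2*h5
  have hm : (1/(1+4*w)) * (1+4*w) = 1 := by field_simp
  refine sol18_of (-6) 2 2 (1/(1+4*w)) ((1+4*w)/3) 2 1 3 (-1) ?_ ?_ ?_ ?_ ?_ ?_ ?_
  · linear_combination hu - (1/3)*he
  · linear_combination 2*hm
  all_goals norm_num

lemma sol18_big (p : ℕ) [Fact p.Prime] (hp2 : p ≠ 2) (hp3 : p ≠ 3) (hp5 : p ≠ 5) :
    Sol18 ℚ_[p] := by
  have D := sq_dich18 p hp2
  obtain ⟨φ, _⟩ : ∃ φ : ℤ_[p] →+* ℚ_[p], True := ⟨algebraMap _ _, trivial⟩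
  have cast2 : ∀ {x y : ℤ_[p]}, x^2 = y → (φ x)^2 = φ y := by
    intro x y h
    rw [← h, map_pow]
  have uprime : ∀ q : ℕ, q.Prime → p ≠ q → IsUnit (q : ℤ_[p]) := by
    intro q hq hne
    rw [PadicInt.isUnit_iff]
    by_contra h
    have hlt : ‖(q : ℤ_[p])‖ < 1 := lt_of_le_of_ne (PadicInt.norm_le_one _) h
    have h3 : (p : ℤ) ∣ (q : ℤ) :=
      (PadicInt.norm_int_lt_one_iff_dvd (p := p) q).mp (by exact_mod_cast hlt)
    have h4 : p ∣ q := by exact_mod_cast h3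
    exact hne ((Nat.prime_dvd_prime_iff_eq (Fact.out) hq).mp h4)
  have u2 : IsUnit (2 : ℤ_[p]) := by exact_mod_cast uprime 2 Nat.prime_two hp2
  have u3 : IsUnit (3 : ℤ_[p]) := by exact_mod_cast uprime 3 Nat.prime_three hp3
  have u5 : IsUnit (5 : ℤ_[p]) := by exact_mod_cast uprime 5 Nat.prime_five hp5
  have um : IsUnit (-1 : ℤ_[p]) := isUnit_one.neg
  rcases D (-1) 2 um u2 with ⟨j, hj⟩ | ⟨r, hr⟩ | ⟨w, hw⟩
  · -- `-1` is a square
    rcases D 2 3 u2 u3 with ⟨r, hr⟩ | ⟨s, hs⟩ | ⟨f, hf⟩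
    · refine sol18_N ((φ j) * (φ r)) ?_
      have h1 := cast2 hj
      have h2 := cast2 hr
      simp only [map_neg, map_one, map_add, map_mul, map_ofNat] at h1 h2
      rw [mul_pow, h1, h2]; ring
    · have h1 := cast2 hj
      have h2 := cast2 hs
      simp only [map_neg, map_one, map_add, map_mul, map_ofNat] at h1 h2
      have uj1 : IsUnit (1 + j) := by
        refine isUnit_of_mul_isUnit_left (y := 1 - j) ?_
        have : (1 + j) * (1 - j) = 2 := by linear_combination -hj
        rwa [this]
      have uj2 : IsUnit (1 + 2*j) := by
        refine isUnit_of_mul_isUnit_left (y := 1 - 2*j) ?_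
        have : (1 + 2*j) * (1 - 2*j) = 5 := by linear_combination -4*hj
        rwa [this]
      -- either `2` is a square (easy), or `1 + j` is a square up to `2`
      rcases D 2 (1+j) u2 uj1 with ⟨r, hr⟩ | hE
      · refine sol18_N ((φ j) * (φ r)) ?_
        have h3 := cast2 hr
        simp only [map_neg, map_one, map_add, map_mul, map_ofNat] at h3
        rw [mul_pow, h1, h3]; ring
      have hE' : ∃ e : ℚ_[p], e^2 = 1 + (φ j) ∨ e^2 = 2 * (1 + (φ j)) := by
        rcases hE with ⟨e, he⟩ | ⟨e, he⟩
        · exact ⟨φ e, Or.inl (by simpa only [map_neg, map_one, map_add, map_mul, map_ofNat] using cast2 he)⟩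
        · exact ⟨φ e, Or.inr (by simpa only [map_neg, map_one, map_add, map_mul, map_ofNat] using cast2 he)⟩
      obtain ⟨e, he⟩ := hE'
      rcases D 5 (1+2*j) u5 uj2 with ⟨v, hv⟩ | ⟨g, hg⟩ | ⟨g, hg⟩
      · have uv : IsUnit (1 + v) := by
          refine isUnit_of_mul_isUnit_left (y := v - 1) ?_
          have : (1 + v) * (v - 1) = 2 * 2 := by linear_combination hv
          rw [this]
          exact u2.mul u2
        have h3 := cast2 hv
        simp only [map_neg, map_one, map_add, map_mul, map_ofNat] at h3
        rcases D 2 (1+v) u2 uv with ⟨r, hr⟩ | ⟨d, hd⟩ | ⟨d, hd⟩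
        · refine sol18_N ((φ j) * (φ r)) ?_
          have h3 := cast2 hr
          simp only [map_neg, map_one, map_add, map_mul, map_ofNat] at h3
          rw [mul_pow, h1, h3]; ring
        · exact sol18_D (φ j) (φ v) (φ d) h1 h3 (by simpa only [map_neg, map_one, map_add, map_mul, map_ofNat] using cast2 hd)
        · have h4 := cast2 hd
          simp only [map_neg, map_one, map_add, map_mul, map_ofNat] at h4
          have hv1 : 1 + (φ v) ≠ 0 := by
            intro h
            have : (1 + (φ v)) * (1 - (φ v)) = -4 := by linear_combination -h3
            rw [h] at this
            norm_num at this
          have hd0 : (φ d) ≠ 0 := sq_ne_zero18 h4 (mul_ne_zero two_ne_zero hv1)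
          have hi : (1/(φ d))^2 * (2 * (1 + (φ v))) = 1 := by rw [← h4]; field_simp
          refine sol18_A (φ j) (φ s) e ((1 + 2*(φ j) + (φ v)) * (1/(φ d))) h1 h2 he (Or.inl ?_)
          linear_combination (1 + 2*(φ j))*hi + (1/(φ d))^2 * h3
            + 4 * (1/(φ d))^2 * h1
      · exact sol18_A (φ j) (φ s) e (φ g) h1 h2 he (Or.inl (by simpa only [map_neg, map_one, map_add, map_mul, map_ofNat] using cast2 hg))
      · exact sol18_A (φ j) (φ s) e (φ g) h1 h2 he (Or.inr (by simpa only [map_neg, map_one, map_add, map_mul, map_ofNat] using cast2 hg))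
    · have h1 := cast2 hj
      have h2 := cast2 hf
      simp only [map_neg, map_one, map_add, map_mul, map_ofNat] at h1 h2
      exact sol18_B (φ j) (φ f) h1 (by rw [h2]; norm_num)
  · -- `2` is a square
    have h1 := cast2 hr
    simp only [map_neg, map_one, map_add, map_mul, map_ofNat] at h1
    have ur : IsUnit (1 + r) := by
      refine isUnit_of_mul_isUnit_left (y := r - 1) ?_
      have : (1 + r) * (r - 1) = 1 := by linear_combination hr
      rw [this]
      exact isUnit_one
    rcases D (-1) (1+r) um ur with ⟨j, hj⟩ | ⟨e, he⟩ | ⟨e, he⟩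
    · refine sol18_N ((φ j) * (φ r)) ?_
      have h2 := cast2 hj
      simp only [map_neg, map_one, map_add, map_mul, map_ofNat] at h2
      rw [mul_pow, h1, h2]; ring
    · exact sol18_C (φ r) (φ e) h1 (Or.inl (by simpa only [map_neg, map_one, map_add, map_mul, map_ofNat] using cast2 he))
    · have h2 := cast2 he
      simp only [map_neg, map_one, map_add, map_mul, map_ofNat] at h2
      exact sol18_C (φ r) (φ e) h1 (Or.inr (by rw [h2]; ring))
  · -- `-2` is a square
    have h1 := cast2 hw
    simp only [map_neg, map_one, map_add, map_mul, map_ofNat] at h1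
    exact sol18_N (φ w) (by rw [h1]; norm_num)

lemma sol18_padic (p : ℕ) [Fact p.Prime] : Sol18 ℚ_[p] := by
  by_cases hp2 : p = 2
  · subst hp2
    exact sol18_two
  by_cases hp3 : p = 3
  · subst hp3
    obtain ⟨w, hw⟩ := sq_lift18 3 (by norm_num) (-2) (by
      rw [IsUnit.neg_iff, PadicInt.isUnit_iff]
      by_contra h
      have hlt : ‖(2 : ℤ_[3])‖ < 1 := lt_of_le_of_ne (PadicInt.norm_le_one _) h
      have := (PadicInt.norm_int_lt_one_iff_dvd (p := 3) 2).mp (by exact_mod_cast hlt)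
      norm_num at this) (by
      rw [map_neg, map_ofNat]
      exact sqm2_18)
    refine sol18_N (w : ℚ_[3]) ?_
    have := congrArg (algebraMap ℤ_[3] ℚ_[3]) hw
    simp only [map_neg, map_pow, map_ofNat] at this
    exact this
  by_cases hp5 : p = 5
  · subst hp5
    obtain ⟨j, hj⟩ := sq_lift18 5 (by norm_num) (-1) isUnit_one.neg (by
      rw [map_neg, map_one]
      exact sqm1_18)
    obtain ⟨f, hf⟩ := sq_lift18 5 (by norm_num) 6 (by
      rw [PadicInt.isUnit_iff]
      by_contra h
      have hlt : ‖(6 : ℤ_[5])‖ < 1 := lt_of_le_of_ne (PadicInt.norm_le_one _) h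
      have := (PadicInt.norm_int_lt_one_iff_dvd (p := 5) 6).mp (by exact_mod_cast hlt)
      norm_num at this) (by
      rw [map_ofNat]
      exact sq6_18)
    refine sol18_B (j : ℚ_[5]) (f : ℚ_[5]) ?_ ?_
    · have := congrArg (algebraMap ℤ_[5] ℚ_[5]) hj
      simp only [map_neg, map_pow, map_one] at this
      exact this
    · have := congrArg (algebraMap ℤ_[5] ℚ_[5]) hf
      simp only [map_pow, map_ofNat] at this
      exact this
  exact sol18_big p hp2 hp3 hp5

end padic

/-- For every prime `p` the system `q₁ = q₂ = q₃ = 0` has a nonzero solution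
over `ℚ_p`, and it has a nonzero solution over `ℝ`; that is, the projective surface
`V ⊂ ℙ⁵` defined by the three quadrics has points over every completion of `ℚ`. -/
theorem statement18 :
    (∀ (p : ℕ) [Fact p.Prime], ∃ x1 x2 x3 x4 x5 x6 : ℚ_[p],
      (x1, x2, x3, x4, x5, x6) ≠ (0, 0, 0, 0, 0, 0) ∧
      x1^2 + 2*x1*x3 + 8*x1*x4 + 10*x1*x5 + 24*x1*x6 + x2^2 + 8*x2*x3 + 10*x2*x4
        + 24*x2*x5 + 58*x2*x6 + 5*x3^2 + 24*x3*x4 + 58*x3*x5 + 152*x3*x6 + 29*x4^2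
        + 152*x4*x5 + 346*x4*x6 + 173*x5^2 + 856*x5*x6 + 1017*x6^2 = 0 ∧
      x1*x2 + 2*x1*x3 + 3*x1*x4 + 6*x1*x5 + 17*x1*x6 + x2^2 + 3*x2*x3 + 6*x2*x4
        + 17*x2*x5 + 40*x2*x6 + 3*x3^2 + 17*x3*x4 + 40*x3*x5 + 97*x3*x6 + 20*x4^2
        + 97*x4*x5 + 230*x4*x6 + 115*x5^2 + 563*x5*x6 + 675*x6^2 = 0 ∧
      6*x1*x3 + 8*x1*x4 + 12*x1*x5 + 30*x1*x6 + 3*x2^2 + 8*x2*x3 + 12*x2*x4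
        + 30*x2*x5 + 84*x2*x6 + 6*x3^2 + 30*x3*x4 + 84*x3*x5 + 192*x3*x6 + 42*x4^2
        + 192*x4*x5 + 466*x4*x6 + 233*x5^2 + 1112*x5*x6 + 1360*x6^2 = 0) ∧
    (∃ x1 x2 x3 x4 x5 x6 : ℝ,
      (x1, x2, x3, x4, x5, x6) ≠ (0, 0, 0, 0, 0, 0) ∧
      x1^2 + 2*x1*x3 + 8*x1*x4 + 10*x1*x5 + 24*x1*x6 + x2^2 + 8*x2*x3 + 10*x2*x4
        + 24*x2*x5 + 58*x2*x6 + 5*x3^2 + 24*x3*x4 + 58*x3*x5 + 152*x3*x6 + 29*x4^2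
        + 152*x4*x5 + 346*x4*x6 + 173*x5^2 + 856*x5*x6 + 1017*x6^2 = 0 ∧
      x1*x2 + 2*x1*x3 + 3*x1*x4 + 6*x1*x5 + 17*x1*x6 + x2^2 + 3*x2*x3 + 6*x2*x4
        + 17*x2*x5 + 40*x2*x6 + 3*x3^2 + 17*x3*x4 + 40*x3*x5 + 97*x3*x6 + 20*x4^2
        + 97*x4*x5 + 230*x4*x6 + 115*x5^2 + 563*x5*x6 + 675*x6^2 = 0 ∧
      6*x1*x3 + 8*x1*x4 + 12*x1*x5 + 30*x1*x6 + 3*x2^2 + 8*x2*x3 + 12*x2*x4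
        + 30*x2*x5 + 84*x2*x6 + 6*x3^2 + 30*x3*x4 + 84*x3*x5 + 192*x3*x6 + 42*x4^2
        + 192*x4*x5 + 466*x4*x6 + 233*x5^2 + 1112*x5*x6 + 1360*x6^2 = 0) := by
  refine ⟨fun p _ => sol18_padic p, ?_⟩
  have h2 : (0:ℝ) ≤ 2 := by norm_num
  exact sol18_C (K := ℝ) (√2) (√(1 + √2)) (Real.sq_sqrt h2) (Or.inl (Real.sq_sqrt (by positivity)))
end
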